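/- arXiv:1802.03630 — 2 statements merged into one kernel-verified Lean document; each statement's English description precedes it below -/
import Mathlib

section
/- Let S = sup_{x∈ℝ} |Sg(x)|, where Sg = g‴/g′ − (3/2)(g″/g′)² is the Schwarzian derivative of g, and let V be the total variation of log∘g′ on [0,1]. Then for every n ≥ 0, every 0 ≤ j ≤ q_{n+1} and every x ∈ ℝ, the Schwarzian derivative of the iterate g^j satisfies |S(g^j)(x)| ≤ Mₙ e^{2V} S / mₙ(x)², where mₙ(x)² = |Iₙ(x)|². -/
open Filter Topology

/-- Gauss-map orbit of `α`: `α₀ = α`, `αₙ₊₁ = 1 / fract(αₙ)`. -/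
noncomputable def cfGauss (α : ℝ) : ℕ → ℝ
  | 0 => α
  | n + 1 => (Int.fract (cfGauss α n))⁻¹

/-- Partial quotients `aₙ` of the continued fraction of `α`. -/
noncomputable def cfA (α : ℝ) (n : ℕ) : ℤ := ⌊cfGauss α n⌋

/-- Numerators `pₙ` of the convergents of `α`. -/
noncomputable def cfP (α : ℝ) : ℕ → ℤ
  | 0 => cfA α 0
  | 1 => cfA α 1 * cfA α 0 + 1
  | n + 2 => cfA α (n + 2) * cfP α (n + 1) + cfP α n

/-- Denominators `qₙ` of the convergents of `α` (as natural numbers). -/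
noncomputable def cfQ (α : ℝ) : ℕ → ℕ
  | 0 => 1
  | 1 => (cfA α 1).toNat
  | n + 2 => (cfA α (n + 2)).toNat * cfQ α (n + 1) + cfQ α n

/-- `gₙ(x) = g^{qₙ}(x) − pₙ`. -/
noncomputable def cfIter (g : ℝ → ℝ) (α : ℝ) (n : ℕ) (x : ℝ) : ℝ :=
  g^[cfQ α n] x - cfP α n

/-- The Schwarzian derivative `Sf = f‴/f′ − (3/2)(f″/f′)²`. -/
noncomputable def schwarzianDeriv (f : ℝ → ℝ) (x : ℝ) : ℝ :=
  iteratedDeriv 3 f x / deriv f x - (3 / 2) * (iteratedDeriv 2 f x / deriv f x) ^ 2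

/-! ### Continued fraction facts -/

theorem aux_irr (α : ℝ) (hα : Irrational α) (n : ℕ) : Irrational (cfGauss α n) := by
  induction n with
  | zero => exact hα
  | succ n ih =>
    have h : Irrational (Int.fract (cfGauss α n)) := by
      rw [Int.fract]; exact ih.sub_intCast _
    exact h.inv

theorem aux_fract_pos (α : ℝ) (hα : Irrational α) (n : ℕ) : 0 < Int.fract (cfGauss α n) := by
  rcases (Int.fract_nonneg (cfGauss α n)).lt_or_eq with h | h
  · exact h
  · exfalso
    have h2 : cfGauss α n = ⌊cfGauss α n⌋ := by
      have := Int.self_sub_floor (cfGauss α n); linarith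
    exact (aux_irr α hα n).ne_int _ h2

theorem aux_A_pos (α : ℝ) (hα : Irrational α) (n : ℕ) : 1 ≤ cfA α (n + 1) := by
  have h := aux_fract_pos α hα n
  have h1 := Int.fract_lt_one (cfGauss α n)
  rw [cfA, Int.le_floor]
  simp only [cfGauss, Int.cast_one]
  exact (one_le_inv₀ h).2 h1.le

theorem aux_toNat (α : ℝ) (hα : Irrational α) (n : ℕ) :
    (((cfA α (n + 1)).toNat : ℕ) : ℤ) = cfA α (n + 1) :=
  Int.toNat_of_nonneg (by have := aux_A_pos α hα n; omega)

theorem aux_Q_pos (α : ℝ) (hα : Irrational α) (n : ℕ) : 0 < cfQ α n ∧ 0 < cfQ α (n + 1) := by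
  induction n with
  | zero =>
    have := aux_A_pos α hα 0
    simp only [cfQ]; simp; simp at this; omega
  | succ n ih =>
    refine ⟨ih.2, ?_⟩
    simp only [cfQ]; have := ih.1; positivity

theorem aux_det (α : ℝ) (hα : Irrational α) (n : ℕ) :
    (cfP α n * cfQ α (n + 1) - cfP α (n + 1) * cfQ α n) ^ 2 = 1 := by
  induction n with
  | zero =>
    have := aux_toNat α hα 0
    simp only [cfP, cfQ, this]; push_cast; ring_nf; 
  | succ n ih =>
    have := aux_toNat α hα (n + 1)
    simp only [cfP, cfQ]; push_cast
    simp only [this]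
    rw [← ih]; ring

/-- `δₙ = qₙ α − pₙ`. -/
noncomputable def auxD (α : ℝ) (n : ℕ) : ℝ := cfQ α n * α - cfP α n

theorem aux_D_rec (α : ℝ) (hα : Irrational α) (n : ℕ) :
    auxD α (n + 1) = - auxD α n * Int.fract (cfGauss α (n + 1)) := by
  induction n with
  | zero =>
    have h := aux_toNat α hα 0
    have h' : ((cfA α 1).toNat : ℝ) = (cfA α 1 : ℝ) := by exact_mod_cast h
    have h0 := aux_fract_pos α hα 0
    have e1 : cfGauss α 1 * Int.fract (cfGauss α 0) = 1 := by
      simp only [cfGauss]; exact inv_mul_cancel₀ h0.ne'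
    have e0 : (cfA α 0 : ℝ) = α - Int.fract (cfGauss α 0) := by
      have := Int.self_sub_floor (cfGauss α 0); rw [cfA, ← this]; simp [cfGauss]
    have e2 : (cfA α 1 : ℝ) = cfGauss α 1 - Int.fract (cfGauss α 1) := by
      have := Int.self_sub_floor (cfGauss α 1); rw [cfA, ← this]; ring
    simp only [auxD, cfQ, cfP, zero_add, h']; push_cast
    rw [e0, e2]
    linear_combination e1
  | succ n ih =>
    have h := aux_toNat α hα (n + 1)
    have h' : ((cfA α (n + 2)).toNat : ℝ) = (cfA α (n + 2) : ℝ) := by exact_mod_cast h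
    have h0 := aux_fract_pos α hα (n + 1)
    have e1 : cfGauss α (n + 2) * Int.fract (cfGauss α (n + 1)) = 1 := by
      rw [cfGauss]; exact inv_mul_cancel₀ h0.ne'
    have e2 : (cfA α (n + 2) : ℝ) = cfGauss α (n + 2) - Int.fract (cfGauss α (n + 2)) := by
      have := Int.self_sub_floor (cfGauss α (n + 2)); rw [cfA, ← this]; ring
    have e3 : auxD α (n + 2) = cfA α (n + 2) * auxD α (n + 1) + auxD α n := by
      simp only [auxD, cfQ, cfP]; push_cast; rw [h']; ring
    rw [show n + 1 + 1 = n + 2 from rfl, e3, e2]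
    linear_combination cfGauss α (n + 2) * ih - auxD α n * e1

theorem aux_D_ne (α : ℝ) (hα : Irrational α) (n : ℕ) : auxD α n ≠ 0 := by
  induction n with
  | zero =>
    have := aux_fract_pos α hα 0
    simp only [cfGauss, Int.fract] at this
    simp only [auxD, cfQ, cfP, cfA, cfGauss]; push_cast; linarith
  | succ n ih =>
    rw [aux_D_rec α hα n]
    exact mul_ne_zero (neg_ne_zero.2 ih) (aux_fract_pos α hα (n + 1)).ne'

theorem aux_D_le_one (α : ℝ) (hα : Irrational α) (n : ℕ) : |auxD α n| ≤ 1 := by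
  induction n with
  | zero =>
    have h1 := aux_fract_pos α hα 0
    have h2 := Int.fract_lt_one (cfGauss α 0)
    have : auxD α 0 = Int.fract (cfGauss α 0) := by
      simp [auxD, cfQ, cfP, cfA, cfGauss]
    rw [this, abs_of_pos h1]; exact h2.le
  | succ n ih =>
    rw [aux_D_rec α hα n, abs_mul, abs_neg, abs_of_pos (aux_fract_pos α hα (n + 1))]
    have h2 := Int.fract_lt_one (cfGauss α (n + 1))
    exact mul_le_one₀ ih (aux_fract_pos α hα (n + 1)).le h2.le

/-- Best approximation. -/
theorem aux_best (α : ℝ) (hα : Irrational α) (n m : ℕ) (k : ℤ) (hm : 0 < m)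
    (hmq : m < cfQ α (n + 1)) : |auxD α n| ≤ |(m : ℝ) * α + k| := by
  have hdet := aux_det α hα n
  obtain ⟨hq0, hq1⟩ := aux_Q_pos α hα n
  set d : ℤ := cfP α n * cfQ α (n + 1) - cfP α (n + 1) * cfQ α n with hd
  have hd2 : d * d = 1 := by rw [← sq]; exact hdet
  set u : ℤ := d * (-k * cfQ α (n + 1) - cfP α (n + 1) * m) with hu
  set v : ℤ := d * (cfP α n * m + k * cfQ α n) with hv
  have e1 : (m : ℤ) = u * cfQ α n + v * cfQ α (n + 1) := by
    rw [hu, hv]; linear_combination (-(m : ℤ)) * hd2 + d * m * hd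
  have e2 : -k = u * cfP α n + v * cfP α (n + 1) := by
    rw [hu, hv]; linear_combination (k : ℤ) * hd2 - d * k * hd
  have e3 : (m : ℝ) * α + k = u * auxD α n + v * auxD α (n + 1) := by
    have e1' : (m : ℝ) = u * cfQ α n + v * cfQ α (n + 1) := by exact_mod_cast e1
    have e2' : -(k : ℝ) = u * cfP α n + v * cfP α (n + 1) := by exact_mod_cast e2
    simp only [auxD]; linear_combination α * e1' - e2'
  have hf := aux_fract_pos α hα (n + 1)
  rw [e3, aux_D_rec α hα n]
  set f := Int.fract (cfGauss α (n + 1))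
  have e4 : (u : ℝ) * auxD α n + v * (-auxD α n * f) = auxD α n * (u - v * f) := by ring
  rw [e4, abs_mul]
  have key : 1 ≤ |(u : ℝ) - v * f| := by
    have hq0' : (0 : ℤ) < cfQ α n := by exact_mod_cast hq0
    have hq1' : (0 : ℤ) < cfQ α (n + 1) := by exact_mod_cast hq1
    have hm' : (0 : ℤ) < m := by exact_mod_cast hm
    have hmq' : (m : ℤ) < cfQ α (n + 1) := by exact_mod_cast hmq
    rcases lt_trichotomy v 0 with hv0 | hv0 | hv0
    · have hu1 : 1 ≤ u := by
        by_contra hc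
        have : u ≤ 0 := by omega
        nlinarith
      have a1 : (1 : ℝ) ≤ u := by exact_mod_cast hu1
      have a2 : (v : ℝ) < 0 := by exact_mod_cast hv0
      refine le_trans ?_ (le_abs_self _)
      nlinarith
    · have hu1 : u ≠ 0 := by
        rintro h; rw [h, hv0] at e1; omega
      rw [hv0]; simp only [Int.cast_zero, zero_mul, sub_zero]
      exact_mod_cast Int.one_le_abs hu1
    · have hu1 : u ≤ -1 := by
        by_contra hc
        have : 0 ≤ u := by omega
        nlinarith
      have a1 : (u : ℝ) ≤ -1 := by exact_mod_cast hu1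
      have a2 : (0 : ℝ) < v := by exact_mod_cast hv0
      refine le_trans ?_ (neg_le_abs _)
      nlinarith
  have := abs_nonneg (auxD α n)
  nlinarith

/-! ### Order of orbits -/

theorem aux_iter_int (g : ℝ → ℝ) (hgper : ∀ x, g (x + 1) = g x + 1) (k : ℤ) (x : ℝ) :
    g (x + k) = g x + k := by
  induction k using Int.induction_on with
  | zero => simp
  | succ i ih =>
    push_cast at ih ⊢; rw [← add_assoc, hgper, ih]; ring
  | pred i ih =>
    push_cast at ih ⊢
    have := hgper (x + (-(i : ℝ) - 1))
    rw [show x + (-(i : ℝ) - 1) + 1 = x + -(i : ℝ) by ring, ih] at this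
    linarith

theorem aux_iter_int' (g : ℝ → ℝ) (hgper : ∀ x, g (x + 1) = g x + 1) (m : ℕ) (k : ℤ) (x : ℝ) :
    g^[m] (x + k) = g^[m] x + k := by
  induction m with
  | zero => simp
  | succ m ih => rw [Function.iterate_succ_apply', Function.iterate_succ_apply', ih,
      aux_iter_int g hgper]

theorem aux_le_mul (g : ℝ → ℝ) (hgmono : StrictMono g) (hgper : ∀ x, g (x + 1) = g x + 1)
    (m : ℕ) (k : ℤ) (y : ℝ) :
    (g^[m] y ≤ y + k → ∀ l : ℕ, g^[m * l] y ≤ y + k * l) ∧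
    (y + k ≤ g^[m] y → ∀ l : ℕ, y + k * l ≤ g^[m * l] y) := by
  have hmono : Monotone (g^[m]) := hgmono.monotone.iterate m
  have e : ∀ l : ℕ, g^[m] (y + k * l) = g^[m] y + k * l := by
    intro l
    have := aux_iter_int' g hgper m (k * l) y
    push_cast at this; exact this
  constructor
  · intro h l
    induction l with
    | zero => simp
    | succ l ih =>
      rw [show m * (l + 1) = m + m * l by ring, Function.iterate_add_apply]
      have := hmono ih
      rw [e] at this; push_cast; linarith
  · intro h l
    induction l with
    | zero => simp
    | succ l ih =>
      rw [show m * (l + 1) = m + m * l by ring, Function.iterate_add_apply]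
      have := hmono ih
      rw [e] at this; push_cast; linarith

theorem aux_cmp (g : ℝ → ℝ) (hgmono : StrictMono g) (hgper : ∀ x, g (x + 1) = g x + 1)
    (α : ℝ) (hrot : ∀ x : ℝ, Tendsto (fun m : ℕ => (g^[m] x - x) / m) atTop (𝓝 α))
    (m : ℕ) (k : ℤ) (y : ℝ) :
    (g^[m] y ≤ y + k → m * α ≤ k) ∧ (y + k ≤ g^[m] y → k ≤ m * α) := by
  rcases Nat.eq_zero_or_pos m with rfl | hm
  · simp
  have hm' : (0 : ℝ) < m := by exact_mod_cast hm
  have ht : Tendsto (fun l : ℕ => m * l) atTop atTop := tendsto_id.const_mul_atTop' hm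
  have h1 := ((hrot y).comp ht).const_mul (m : ℝ)
  obtain ⟨ha, hb⟩ := aux_le_mul g hgmono hgper m k y
  have e : ∀ l : ℕ, 0 < l → (m : ℝ) * ((g^[m * l] y - y) / ((m * l : ℕ) : ℝ))
      = (g^[m * l] y - y) / l := by
    intro l hl
    have : (0 : ℝ) < l := by exact_mod_cast hl
    push_cast; field_simp
  constructor
  · intro h
    refine le_of_tendsto h1 ?_
    filter_upwards [eventually_gt_atTop 0] with l hl
    have : (0 : ℝ) < l := by exact_mod_cast hl
    simp only [Function.comp]
    rw [e l hl, div_le_iff₀ this]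
    linarith [ha h l]
  · intro h
    refine ge_of_tendsto h1 ?_
    filter_upwards [eventually_gt_atTop 0] with l hl
    have : (0 : ℝ) < l := by exact_mod_cast hl
    simp only [Function.comp]
    rw [e l hl, le_div_iff₀ this]
    linarith [hb h l]

/-- Order of orbits agrees with the rotation. -/
theorem aux_order (g : ℝ → ℝ) (hgmono : StrictMono g) (hgper : ∀ x, g (x + 1) = g x + 1)
    (α : ℝ) (hα : Irrational α)
    (hrot : ∀ x : ℝ, Tendsto (fun m : ℕ => (g^[m] x - x) / m) atTop (𝓝 α))
    (a c : ℕ) (b d : ℤ) (x : ℝ) (h : (a : ℝ) * α + b ≤ c * α + d) :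
    g^[a] x + b ≤ g^[c] x + d := by
  by_contra hcon
  push Not at hcon
  have key : (c : ℝ) * α + d ≤ a * α + b := by
    rcases le_total a c with hac | hac
    · obtain ⟨m, rfl⟩ := Nat.exists_eq_add_of_le' hac
      rw [Function.iterate_add_apply] at hcon
      have := (aux_cmp g hgmono hgper α hrot m (b - d) (g^[a] x)).1 (by push_cast; linarith)
      push_cast at this ⊢; linarith
    · obtain ⟨m, rfl⟩ := Nat.exists_eq_add_of_le' hac
      rw [Function.iterate_add_apply] at hcon
      have := (aux_cmp g hgmono hgper α hrot m (d - b) (g^[c] x)).2 (by push_cast; linarith)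
      push_cast at this ⊢; linarith
  have heq : ((a : ℤ) - c : ℤ) * α = ((d - b : ℤ) : ℝ) := by push_cast; linarith
  have hz : (a : ℤ) - c = 0 := by
    by_contra hne
    have := hα.intCast_mul hne
    rw [heq] at this
    exact this.ne_int _ rfl
  have hac : a = c := by omega
  subst hac
  simp only [sub_self, Int.cast_zero, zero_mul] at heq
  push_cast at heq
  linarith

/-! ### Disjoint intervals -/

theorem aux_sum_disj (W : ℝ → ℝ) (hW : Monotone W) (a b : ℕ → ℝ) (A : ℝ) (s : Finset ℕ) :
    (∀ i ∈ s, A ≤ a i) → (∀ i ∈ s, a i < b i) →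
    (∀ i ∈ s, ∀ j ∈ s, i ≠ j → b i ≤ a j ∨ b j ≤ a i) →
    ∀ B : ℝ, A ≤ B → (∀ i ∈ s, b i ≤ B) → ∑ i ∈ s, (W (b i) - W (a i)) ≤ W B - W A := by
  induction s using Finset.induction_on_max_value a with
  | empty => intro _ _ _ B hB _; simpa using hW hB
  | insert i s hi hmax ih =>
    intro h1 h2 h3 B hB h4
    rw [Finset.sum_insert hi]
    have := ih (fun j hj => h1 j (Finset.mem_insert_of_mem hj))
      (fun j hj => h2 j (Finset.mem_insert_of_mem hj))
      (fun j hj k hk => h3 j (Finset.mem_insert_of_mem hj) k (Finset.mem_insert_of_mem hk))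
      (a i) (h1 i (Finset.mem_insert_self i s)) (by
        intro j hj
        have hne : j ≠ i := by rintro rfl; exact hi hj
        rcases h3 j (Finset.mem_insert_of_mem hj) i (Finset.mem_insert_self i s) hne with h | h
        · exact h
        · have := hmax j hj
          have := h2 i (Finset.mem_insert_self i s)
          linarith)
    have := hW (h4 i (Finset.mem_insert_self i s))
    linarith

theorem aux_W_int (W : ℝ → ℝ) (V : ℝ) (hper : ∀ x, W (x + 1) = W x + V) (k : ℤ) (x : ℝ) :
    W (x + k) = W x + k * V := by
  induction k using Int.induction_on with
  | zero => simp
  | succ i ih =>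
    push_cast at ih ⊢; rw [← add_assoc, hper, ih]; ring
  | pred i ih =>
    push_cast at ih ⊢
    have := hper (x + (-(i : ℝ) - 1))
    rw [show x + (-(i : ℝ) - 1) + 1 = x + -(i : ℝ) by ring, ih] at this
    linarith

theorem aux_sum_orbit (g : ℝ → ℝ) (hgmono : StrictMono g) (hgper : ∀ x, g (x + 1) = g x + 1)
    (z w : ℝ) (hzw : z < w) (hw1 : w ≤ z + 1) (q : ℕ)
    (hP : ∀ m : ℕ, 0 < m → m < q → ∀ k : ℤ, w ≤ g^[m] z + k ∨ g^[m] w + k ≤ z)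
    (W : ℝ → ℝ) (hW : Monotone W) (V : ℝ) (hper : ∀ x, W (x + 1) = W x + V) :
    ∑ i ∈ Finset.range q, (W (g^[i] w) - W (g^[i] z)) ≤ V := by
  let κ : ℕ → ℤ := fun i => ⌊g^[i] z - z⌋
  have hκ1 : ∀ i, z ≤ g^[i] z + (-κ i : ℤ) := fun i => by
    have := Int.floor_le (g^[i] z - z); push_cast; simp only [κ]; linarith
  have hκ2 : ∀ i, g^[i] z + (-κ i : ℤ) < z + 1 := fun i => by
    have := Int.lt_floor_add_one (g^[i] z - z); push_cast; simp only [κ]; linarith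
  have hmono : ∀ i, StrictMono (g^[i]) := fun i => hgmono.iterate i
  have hpair : ∀ i j : ℕ, i < j → j < q → 
      g^[i] w + (-κ i : ℤ) ≤ g^[j] z + (-κ j : ℤ) ∨ 
      g^[j] w + (-κ j : ℤ) ≤ g^[i] z + (-κ i : ℤ) := by
    intro i j hij hj
    obtain ⟨m, rfl⟩ := Nat.exists_eq_add_of_lt hij
    have e : ∀ t, g^[i + m + 1] t = g^[i] (g^[m + 1] t) := fun t => by
      rw [← Function.iterate_add_apply]; congr 1
    rcases hP (m + 1) (by omega) (by omega) (κ i - κ (i + m + 1)) with h | h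
    · left
      have := (hmono i).monotone h
      rw [aux_iter_int' g hgper, ← e] at this
      push_cast at this ⊢; linarith
    · right
      have := (hmono i).monotone h
      rw [aux_iter_int' g hgper, ← e] at this
      push_cast at this ⊢; linarith
  have main := aux_sum_disj W hW (fun i => g^[i] z + (-κ i : ℤ)) (fun i => g^[i] w + (-κ i : ℤ)) z
    (Finset.range q) (fun i _ => hκ1 i)
    (fun i _ => by have := hmono i hzw; simpa using this)
    (by
      intro i hi j hj hne
      rw [Finset.mem_range] at hi hj
      rcases lt_or_gt_of_ne hne with h | h
      · exact hpair i j h hj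
      · exact (hpair j i h hi).symm)
    (z + 1) (by linarith)
    (by
      intro i hi
      rw [Finset.mem_range] at hi
      rcases Nat.eq_zero_or_pos i with rfl | hpos
      · simpa [κ] using hw1
      · rcases hP i hpos hi (-κ i - 1) with h | h
        · have := hκ2 i
          push_cast at h this; linarith
        · push_cast at h ⊢; linarith)
  rw [hper] at main
  have e : ∀ i, W (g^[i] w + (-κ i : ℤ)) - W (g^[i] z + (-κ i : ℤ)) = W (g^[i] w) - W (g^[i] z) := by
    intro i; rw [aux_W_int W V hper, aux_W_int W V hper]; ring
  simp only [e] at main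
  linarith

/-! ### Variation -/

theorem aux_exists_W (φ : ℝ → ℝ) (hφ : ContDiff ℝ 1 φ) (hper : ∀ x, φ (x + 1) = φ x) :
    ∃ W : ℝ → ℝ, Monotone W ∧
      (∀ x, W (x + 1) = W x + (eVariationOn φ (Set.Icc 0 1)).toReal) ∧
      ∀ a b x y, x ∈ Set.Icc a b → y ∈ Set.Icc a b → φ x - φ y ≤ W b - W a := by
  have hdper : Function.Periodic (deriv φ) 1 := by
    intro x
    have : (fun t => φ (t + 1)) = φ := funext hper
    rw [← deriv_comp_add_const φ 1 x, this]
  have hdc : Continuous (deriv φ) := hφ.continuous_deriv le_rfl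
  obtain ⟨C, hC⟩ := (hdper.isBounded_of_continuous one_ne_zero hdc).exists_norm_le
  have hlip : LipschitzWith C.toNNReal φ := by
    refine lipschitzWith_of_nnnorm_deriv_le (hφ.differentiable one_ne_zero) ?_
    intro x
    have := hC _ (Set.mem_range_self x)
    rw [← NNReal.coe_le_coe, coe_nnnorm]
    exact this.trans (Real.le_coe_toNNReal C)
  have hlbv : LocallyBoundedVariationOn φ Set.univ := hlip.locallyBoundedVariationOn _
  refine ⟨variationOnFromTo φ Set.univ 0, ?_, ?_, ?_⟩
  · exact monotoneOn_univ.1 (variationOnFromTo.monotoneOn hlbv (Set.mem_univ 0))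
  · intro x
    have shift : ∀ a b : ℝ, eVariationOn φ (Set.Icc (a + 1) (b + 1)) = eVariationOn φ (Set.Icc a b) := by
      intro a b
      have h := eVariationOn.comp_eq_of_monotoneOn φ (t := Set.Icc a b) (fun t => t + 1)
        (fun s _ t _ h => by simpa using h)
      rw [Set.image_add_const_Icc] at h
      rw [← h]
      congr 1
      exact funext hper
    have s2 : variationOnFromTo φ Set.univ 1 (x + 1) = variationOnFromTo φ Set.univ 0 x := by
      have h01 := shift 0 x
      have h02 := shift x 0
      rw [zero_add] at h01 h02
      rcases le_total 0 x with h | h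
      · rw [variationOnFromTo.eq_of_le _ _ h, variationOnFromTo.eq_of_le _ _ (by linarith)]
        simp only [Set.univ_inter, h01]
      · rw [variationOnFromTo.eq_of_ge _ _ h, variationOnFromTo.eq_of_ge _ _ (by linarith)]
        simp only [Set.univ_inter, h02]
    rw [← variationOnFromTo.add hlbv (Set.mem_univ 0) (Set.mem_univ 1) (Set.mem_univ (x + 1)), s2,
      variationOnFromTo.eq_of_le φ _ (zero_le_one' ℝ), Set.univ_inter, add_comm]
  · intro a b x y hx hy
    have hab : a ≤ b := hx.1.trans hx.2
    rw [variationOnFromTo.sub_right hlbv (Set.mem_univ _) (Set.mem_univ _) (Set.mem_univ _),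
      variationOnFromTo.eq_of_le _ _ hab, Set.univ_inter]
    have hb : BoundedVariationOn φ (Set.Icc a b) := by
      have := hlbv a b (Set.mem_univ _) (Set.mem_univ _)
      rwa [Set.univ_inter] at this
    exact hb.sub_le hx hy

/-! ### Schwarzian cocycle -/

theorem aux_schw_comp (f h : ℝ → ℝ) (hf : ContDiff ℝ 3 f) (hh : ContDiff ℝ 3 h)
    (hf' : ∀ x, 0 < deriv f x) (hh' : ∀ x, 0 < deriv h x) (x : ℝ) :
    schwarzianDeriv (f ∘ h) x =
      schwarzianDeriv f (h x) * (deriv h x) ^ 2 + schwarzianDeriv h x := by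
  have df : Differentiable ℝ f := hf.differentiable (by norm_num)
  have dh : Differentiable ℝ h := hh.differentiable (by norm_num)
  have cf1 : ContDiff ℝ 2 (deriv f) := hf.deriv' 
  have ch1 : ContDiff ℝ 2 (deriv h) := hh.deriv'
  have df1 : Differentiable ℝ (deriv f) := cf1.differentiable (by norm_num)
  have dh1 : Differentiable ℝ (deriv h) := ch1.differentiable (by norm_num)
  have cf2 : ContDiff ℝ 1 (deriv (deriv f)) := cf1.deriv'
  have ch2 : ContDiff ℝ 1 (deriv (deriv h)) := ch1.deriv'
  have df2 : Differentiable ℝ (deriv (deriv f)) := cf2.differentiable (by norm_num)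
  have dh2 : Differentiable ℝ (deriv (deriv h)) := ch2.differentiable (by norm_num)
  have e1 : deriv (f ∘ h) = fun x => deriv f (h x) * deriv h x := by
    funext x
    exact ((df (h x)).hasDerivAt.comp x (dh x).hasDerivAt).deriv
  have e2 : deriv (deriv (f ∘ h)) = fun x =>
      (deriv (deriv f) (h x) * deriv h x) * deriv h x + deriv f (h x) * deriv (deriv h) x := by
    rw [e1]; funext x
    exact (((df1 (h x)).hasDerivAt.comp x (dh x).hasDerivAt).mul (dh1 x).hasDerivAt).deriv
  have e3 : deriv (deriv (deriv (f ∘ h))) x =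
      (((deriv (deriv (deriv f)) (h x) * deriv h x) * deriv h x +
        deriv (deriv f) (h x) * deriv (deriv h) x) * deriv h x +
        (deriv (deriv f) (h x) * deriv h x) * deriv (deriv h) x) +
      ((deriv (deriv f) (h x) * deriv h x) * deriv (deriv h) x +
        deriv f (h x) * deriv (deriv (deriv h)) x) := by
    rw [e2]
    exact (((((df2 (h x)).hasDerivAt.comp x (dh x).hasDerivAt).mul (dh1 x).hasDerivAt).mul
      (dh1 x).hasDerivAt).add
      (((df1 (h x)).hasDerivAt.comp x (dh x).hasDerivAt).mul (dh2 x).hasDerivAt)).deriv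
  have i3 : ∀ u : ℝ → ℝ, iteratedDeriv 3 u = deriv (deriv (deriv u)) := fun u => by
    rw [iteratedDeriv_succ, iteratedDeriv_succ, iteratedDeriv_one]
  have i2 : ∀ u : ℝ → ℝ, iteratedDeriv 2 u = deriv (deriv u) := fun u => by
    rw [iteratedDeriv_succ, iteratedDeriv_one]
  simp only [schwarzianDeriv, i3, i2]
  rw [e3, e2, e1]
  have a1 := (hf' (h x)).ne'
  have a2 := (hh' x).ne'
  simp only
  field_simp
  ring

theorem aux_iter_deriv (g : ℝ → ℝ) (hg : ContDiff ℝ 3 g) (hgder : ∀ x, 0 < deriv g x) (i : ℕ) :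
    ContDiff ℝ 3 (g^[i]) ∧ (∀ x, 0 < deriv (g^[i]) x) ∧
    ∀ x, Real.log (deriv (g^[i]) x) = ∑ k ∈ Finset.range i, Real.log (deriv g (g^[k] x)) := by
  induction i with
  | zero => simp [contDiff_id, Function.iterate_zero]
  | succ i ih =>
    obtain ⟨h1, h2, h3⟩ := ih
    have e : ∀ x, deriv (g^[i + 1]) x = deriv g (g^[i] x) * deriv (g^[i]) x := by
      intro x
      rw [Function.iterate_succ']
      exact (((hg.differentiable (by norm_num)) _).hasDerivAt.comp x
        ((h1.differentiable (by norm_num)) x).hasDerivAt).deriv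
    refine ⟨?_, ?_, ?_⟩
    · rw [Function.iterate_succ']; exact hg.comp h1
    · intro x; rw [e]; exact mul_pos (hgder _) (h2 x)
    · intro x
      rw [e, Real.log_mul (hgder _).ne' (h2 x).ne', h3, Finset.sum_range_succ, add_comm]

theorem aux_schw_iter (g : ℝ → ℝ) (hg : ContDiff ℝ 3 g) (hgder : ∀ x, 0 < deriv g x) (j : ℕ)
    (x : ℝ) : schwarzianDeriv (g^[j]) x =
      ∑ i ∈ Finset.range j, schwarzianDeriv g (g^[i] x) * (deriv (g^[i]) x) ^ 2 := by
  induction j with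
  | zero =>
    have e : deriv (fun x : ℝ => x) = fun _ => 1 := by funext y; simp
    simp [schwarzianDeriv, iteratedDeriv_succ, Function.iterate_zero, id_def, e]
  | succ j ih =>
    obtain ⟨h1, h2, -⟩ := aux_iter_deriv g hg hgder j
    rw [Function.iterate_succ', aux_schw_comp g _ hg h1 hgder h2, ih, Finset.sum_range_succ,
      add_comm]

theorem aux_bdd (f : ℝ → ℝ) (hf : Continuous f) (hper : ∀ x, f (x + 1) = f x) :
    BddAbove (Set.range fun x => |f x|) := by
  have hp : Function.Periodic f 1 := hper
  obtain ⟨C, hC⟩ := (hp.isBounded_of_continuous one_ne_zero hf).exists_norm_le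
  refine ⟨C, ?_⟩
  rintro _ ⟨x, rfl⟩
  exact hC _ (Set.mem_range_self x)

theorem aux_deriv_per (f : ℝ → ℝ) (c : ℝ) (h : ∀ x, f (x + 1) = f x + c) (x : ℝ) :
    deriv f (x + 1) = deriv f x := by
  have : (fun t => f (t + 1)) = fun t => f t + c := funext h
  rw [← deriv_comp_add_const f 1 x, this, deriv_add_const]

theorem aux_schw_bdd (g : ℝ → ℝ) (hg : ContDiff ℝ 3 g) (hgder : ∀ x, 0 < deriv g x)
    (hgper : ∀ x, g (x + 1) = g x + 1) :
    BddAbove (Set.range fun x => |schwarzianDeriv g x|) := by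
  have i3 : iteratedDeriv 3 g = deriv (deriv (deriv g)) := by
    rw [iteratedDeriv_succ, iteratedDeriv_succ, iteratedDeriv_one]
  have i2 : iteratedDeriv 2 g = deriv (deriv g) := by
    rw [iteratedDeriv_succ, iteratedDeriv_one]
  apply aux_bdd
  · have c1 : Continuous (deriv g) := hg.continuous_deriv (by norm_num)
    have c2 : Continuous (iteratedDeriv 2 g) := hg.continuous_iteratedDeriv 2 (by norm_num)
    have c3 : Continuous (iteratedDeriv 3 g) := hg.continuous_iteratedDeriv 3 (by norm_num)
    unfold schwarzianDeriv
    exact (c3.div c1 fun x => (hgder x).ne').sub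
      (((c2.div c1 fun x => (hgder x).ne').pow 2).const_mul _ |>.congr fun x => rfl)
  · intro x
    have p1 := aux_deriv_per g 1 hgper
    have p2 := aux_deriv_per (deriv g) 0 (by simpa using p1)
    have p3 := aux_deriv_per (deriv (deriv g)) 0 (by simpa using p2)
    simp only [schwarzianDeriv, i2, i3, p1, p2, p3]

/-- The core estimate for a wandering interval. -/
theorem aux_core (g : ℝ → ℝ) (hg : ContDiff ℝ 3 g) (hgmono : StrictMono g)
    (hgder : ∀ x, 0 < deriv g x) (hgper : ∀ x, g (x + 1) = g x + 1)
    (S V M : ℝ) (hS : ∀ x, |schwarzianDeriv g x| ≤ S)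
    (hV : V = (eVariationOn (fun t => Real.log (deriv g t)) (Set.Icc 0 1)).toReal)
    (z w : ℝ) (hzw : z < w) (hw1 : w ≤ z + 1) (q : ℕ)
    (hP : ∀ m : ℕ, 0 < m → m < q → ∀ k : ℤ, w ≤ g^[m] z + k ∨ g^[m] w + k ≤ z)
    (hM : ∀ i, g^[i] w - g^[i] z ≤ M)
    (x : ℝ) (hx : x ∈ Set.Icc z w) (j : ℕ) (hj : j ≤ q) :
    |schwarzianDeriv (g^[j]) x| ≤ M * Real.exp (2 * V) * S / (w - z) ^ 2 := by
  have hS0 : 0 ≤ S := (abs_nonneg _).trans (hS 0)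
  have hL : 0 < w - z := by linarith
  have hmono : ∀ i, StrictMono (g^[i]) := fun i => hgmono.iterate i
  have hcd : ContDiff ℝ 2 (deriv g) := hg.deriv'
  obtain ⟨W, hW, hWper, hWφ⟩ := aux_exists_W (fun t => Real.log (deriv g t))
    ((hcd.of_le (by norm_num)).log fun x => (hgder x).ne')
    (fun x => by simp only [aux_deriv_per g 1 hgper x])
  rw [← hV] at hWper
  have hsumV := aux_sum_orbit g hgmono hgper z w hzw hw1 q hP W hW V hWper
  have hsum1 := aux_sum_orbit g hgmono hgper z w hzw hw1 q hP id monotone_id 1 (fun _ => rfl)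
  simp only [id] at hsum1
  have hder : ∀ i, i < q → deriv (g^[i]) x ≤ Real.exp V * ((g^[i] w - g^[i] z) / (w - z)) := by
    intro i hi
    obtain ⟨h1, h2, h3⟩ := aux_iter_deriv g hg hgder i
    obtain ⟨y, hy, hye⟩ := exists_deriv_eq_slope (g^[i]) hzw h1.continuous.continuousOn
      (h1.differentiable (by norm_num)).differentiableOn
    rw [← hye]
    have hlog : Real.log (deriv (g^[i]) x) - Real.log (deriv (g^[i]) y) ≤ V := by
      rw [h3, h3, ← Finset.sum_sub_distrib]
      calc _ ≤ ∑ k ∈ Finset.range i, (W (g^[k] w) - W (g^[k] z)) := by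
            refine Finset.sum_le_sum fun k _ => hWφ _ _ _ _ ?_ ?_
            · exact ⟨(hmono k).monotone hx.1, (hmono k).monotone hx.2⟩
            · exact ⟨(hmono k).monotone hy.1.le, (hmono k).monotone hy.2.le⟩
        _ ≤ ∑ k ∈ Finset.range q, (W (g^[k] w) - W (g^[k] z)) := by
            refine Finset.sum_le_sum_of_subset_of_nonneg (Finset.range_mono hi.le) fun k _ _ => ?_
            have := hW ((hmono k).monotone hzw.le)
            linarith
        _ ≤ V := hsumV
    rw [← Real.log_le_log_iff (h2 x) (mul_pos (Real.exp_pos _) (h2 y)),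
      Real.log_mul (Real.exp_pos _).ne' (h2 y).ne', Real.log_exp]
    linarith
  have hli : ∀ i, 0 < g^[i] w - g^[i] z := fun i => by linarith [hmono i hzw]
  rw [aux_schw_iter g hg hgder]
  calc _ ≤ ∑ i ∈ Finset.range j, |schwarzianDeriv g (g^[i] x) * (deriv (g^[i]) x) ^ 2| :=
        Finset.abs_sum_le_sum_abs _ _
    _ ≤ ∑ i ∈ Finset.range j, (M * Real.exp (2 * V) * S / (w - z) ^ 2) * (g^[i] w - g^[i] z) := by
        refine Finset.sum_le_sum fun i hi => ?_
        rw [Finset.mem_range] at hi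
        have hd := hder i (by omega)
        have hd0 := (aux_iter_deriv g hg hgder i).2.1 x
        rw [abs_mul, abs_of_nonneg (sq_nonneg (deriv (g^[i]) x))]
        have hsq : (deriv (g^[i]) x) ^ 2 ≤
            (Real.exp V * ((g^[i] w - g^[i] z) / (w - z))) ^ 2 := by gcongr
        calc _ ≤ S * (Real.exp V * ((g^[i] w - g^[i] z) / (w - z))) ^ 2 := by
              have := hS (g^[i] x)
              gcongr
          _ = (g^[i] w - g^[i] z) * (Real.exp (2 * V) * S / (w - z) ^ 2) *
              (g^[i] w - g^[i] z) := by
              rw [two_mul, Real.exp_add]; field_simp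
          _ ≤ M * (Real.exp (2 * V) * S / (w - z) ^ 2) * (g^[i] w - g^[i] z) := by
              have := hM i
              have := hli i
              gcongr
          _ = _ := by ring
    _ ≤ ∑ i ∈ Finset.range q, (M * Real.exp (2 * V) * S / (w - z) ^ 2) * (g^[i] w - g^[i] z) := by
        refine Finset.sum_le_sum_of_subset_of_nonneg (Finset.range_mono hj) fun k _ _ => ?_
        have hM0 : 0 ≤ M := (hli 0).le.trans (hM 0)
        have := hli k
        positivity
    _ ≤ _ := by
        rw [← Finset.mul_sum]
        have hM0 : 0 ≤ M := (hli 0).le.trans (hM 0)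
        exact mul_le_of_le_one_right (by positivity) hsum1

/-- **Schwarzian derivative estimates for iterates.**
Let `g` be the lift of an orientation-preserving `C³` circle diffeomorphism with irrational
rotation number `α`, with `S = sup |Sg|` and `V = Var_{[0,1]} log g′`.  Then for all `n`,
`0 ≤ j ≤ q_{n+1}` and `x`, `|S(g^j)(x)| ≤ Mₙ e^{2V} S / mₙ(x)²`. -/
theorem schwarzian_estimate_for_iterates
    (g : ℝ → ℝ) (hg : ContDiff ℝ 3 g) (hgmono : StrictMono g)
    (hgsurj : Function.Surjective g) (hgder : ∀ x, 0 < deriv g x)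
    (hgper : ∀ x, g (x + 1) = g x + 1)
    (α : ℝ) (hα : Irrational α)
    (hrot : ∀ x : ℝ, Tendsto (fun m : ℕ => (g^[m] x - x) / m) atTop (𝓝 α))
    (S V : ℝ)
    (hS : S = ⨆ x : ℝ, |schwarzianDeriv g x|)
    (hV : V = (eVariationOn (fun t => Real.log (deriv g t)) (Set.Icc 0 1)).toReal)
    (n : ℕ) (j : ℕ) (hj : j ≤ cfQ α (n + 1)) (x : ℝ) :
    |schwarzianDeriv (g^[j]) x| ≤
      (⨆ y : ℝ, |cfIter g α n y - y|) * Real.exp (2 * V) * S /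
        (cfIter g α n x - x) ^ 2 := by
  have hSle : ∀ y, |schwarzianDeriv g y| ≤ S := by
    intro y; rw [hS]; exact le_ciSup (aux_schw_bdd g hg hgder hgper) y
  have hiter : ∀ (i : ℕ) (y : ℝ), cfIter g α n (g^[i] y) = g^[i] (cfIter g α n y) := by
    intro i y
    have := aux_iter_int' g hgper i (-cfP α n) (g^[cfQ α n] y)
    push_cast at this
    rw [cfIter, cfIter, sub_eq_add_neg (g^[cfQ α n] y), this, ← Function.iterate_add_apply,
      ← Function.iterate_add_apply, add_comm i, sub_eq_add_neg]
  have hMb : BddAbove (Set.range fun y => |cfIter g α n y - y|) := by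
    apply aux_bdd (fun y => cfIter g α n y - y)
    · unfold cfIter
      exact ((hg.continuous.iterate _).sub continuous_const).sub continuous_id
    · intro y
      have := aux_iter_int' g hgper (cfQ α n) 1 y
      push_cast at this
      simp only [cfIter, this]; ring
  have hMle : ∀ i : ℕ, |g^[i] (cfIter g α n x) - g^[i] x| ≤ ⨆ y : ℝ, |cfIter g α n y - y| := by
    intro i; rw [← hiter]; exact le_ciSup hMb (g^[i] x)
  have hord := aux_order g hgmono hgper α hα hrot
  have hc : cfIter g α n x = g^[cfQ α n] x + (-cfP α n : ℤ) := by
    rw [cfIter]; push_cast; ring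
  have hcm : ∀ m : ℕ, g^[m] (cfIter g α n x) = g^[m + cfQ α n] x + (-cfP α n : ℤ) := by
    intro m; rw [hc, aux_iter_int' g hgper, Function.iterate_add_apply]
  have hD1 := aux_D_le_one α hα n
  have hDne := aux_D_ne α hα n
  have hDdef : auxD α n = cfQ α n * α - cfP α n := rfl
  have hbest := aux_best α hα n
  have hne : cfIter g α n x ≠ x := by
    intro h
    have hcmp := aux_cmp g hgmono hgper α hrot (cfQ α n) (cfP α n) x
    have hh : g^[cfQ α n] x = x + cfP α n := by rw [cfIter] at h; linarith
    have h1 := hcmp.1 hh.le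
    have h2 := hcmp.2 hh.ge
    exact hDne (by rw [hDdef]; linarith)
  rcases lt_or_gt_of_ne hDne with hD | hD
  · -- negative case
    rw [abs_of_neg hD] at hD1
    simp only [abs_of_neg hD] at hbest
    have hle : cfIter g α n x ≤ x := by
      have := hord (cfQ α n) 0 (-cfP α n) 0 x (by push_cast; linarith)
      rw [hc]; simpa using this
    have hlt := lt_of_le_of_ne hle hne
    have := aux_core g hg hgmono hgder hgper S V _ hSle hV (cfIter g α n x) x hlt
      (by
        have := hord 0 (cfQ α n) 0 (-cfP α n + 1) x (by push_cast; linarith)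
        rw [hc]; push_cast at this ⊢; simp only [Function.iterate_zero, id] at this; linarith)
      (cfQ α (n + 1))
      (by
        intro m hm0 hmq k
        rcases le_abs.1 (hbest m k hm0 hmq) with h | h
        · left
          have := hord 0 (m + cfQ α n) 0 (-cfP α n + k) x (by push_cast; linarith)
          rw [hcm]; push_cast at this ⊢; simp only [Function.iterate_zero, id] at this; linarith
        · right
          have := hord m (cfQ α n) k (-cfP α n) x (by push_cast; linarith)
          rw [hc]; exact this)
      (fun i => by have := hMle i; rw [abs_sub_comm] at this; exact (le_abs_self _).trans this)
      x ⟨hle, le_rfl⟩ j hj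
    rwa [show (x - cfIter g α n x) ^ 2 = (cfIter g α n x - x) ^ 2 by ring] at this
  · rw [abs_of_pos hD] at hD1
    simp only [abs_of_pos hD] at hbest
    have hle : x ≤ cfIter g α n x := by
      have := hord 0 (cfQ α n) 0 (-cfP α n) x (by push_cast; linarith)
      rw [hc]; simpa using this
    have hlt := lt_of_le_of_ne hle hne.symm
    exact aux_core g hg hgmono hgder hgper S V _ hSle hV x (cfIter g α n x) hlt
      (by
        have := hord (cfQ α n) 0 (-cfP α n) 1 x (by push_cast; linarith)
        rw [hc]; push_cast at this ⊢; simp only [Function.iterate_zero, id] at this; linarith)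
      (cfQ α (n + 1))
      (by
        intro m hm0 hmq k
        rcases le_abs.1 (hbest m k hm0 hmq) with h | h
        · left
          have := hord (cfQ α n) m (-cfP α n) k x (by push_cast; linarith)
          rw [hc]; exact this
        · right
          have := hord (m + cfQ α n) 0 (-cfP α n + k) 0 x (by push_cast; linarith)
          rw [hcm]; push_cast at this ⊢; simp only [Function.iterate_zero, id] at this; linarith)
      (fun i => (le_abs_self _).trans (hMle i))
      x ⟨le_rfl, hle⟩ j hj
end

section
/- Let S = sup_{x∈ℝ} |Sg(x)|, where Sg = g‴/g′ − (3/2)(g″/g′)² is the Schwarzian derivative of g, let V be the total variation of log∘g′ on [0,1], and set c = √(2S) e^V. Then for every n ≥ 0 and every 0 ≤ j ≤ 2q_{n+1}, the nonlinearity of the iterate g^j satisfies sup_{x∈ℝ} |(g^j)″(x)/(g^j)′(x)| ≤ c · Mₙ^{1/2} / mₙ*. -/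
open Filter Topology

/-- Third order jet data of an orientation preserving diffeomorphism of the line: derivative `D`,
nonlinearity `u`, Schwarzian `s`. -/
structure NJet (f D u s : ℝ → ℝ) : Prop where
  hf : ∀ x, HasDerivAt f (D x) x
  pos : ∀ x, 0 < D x
  hD : ∀ x, HasDerivAt D (D x * u x) x
  hu : ∀ x, HasDerivAt u (u x ^ 2 / 2 + s x) x

namespace NJet

theorem unique {f D u s D' u' s' : ℝ → ℝ} (h : NJet f D u s) (h' : NJet f D' u' s') :
    D = D' ∧ u = u' ∧ s = s' := by
  have h1 : D = D' := funext fun x => (h.hf x).unique (h'.hf x)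
  subst h1
  have h2 : u = u' := by
    funext x
    have := (h.hD x).unique (h'.hD x)
    exact mul_left_cancel₀ (h.pos x).ne' this
  subst h2
  refine ⟨rfl, rfl, ?_⟩
  funext x
  have := (h.hu x).unique (h'.hu x)
  linarith

theorem id : NJet (fun x => x) (fun _ => 1) (fun _ => 0) (fun _ => 0) where
  hf x := hasDerivAt_id x
  pos x := one_pos
  hD x := by simpa using hasDerivAt_const x (1:ℝ)
  hu x := by simpa using hasDerivAt_const x (0:ℝ)

theorem comp {f D u s f' D' u' s' : ℝ → ℝ} (h : NJet f D u s) (h' : NJet f' D' u' s') :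
    NJet (fun x => f (f' x)) (fun x => D (f' x) * D' x) (fun x => u' x + D' x * u (f' x))
      (fun x => s' x + D' x ^ 2 * s (f' x)) where
  hf x := (h.hf (f' x)).comp x (h'.hf x)
  pos x := mul_pos (h.pos _) (h'.pos _)
  hD x := by
    have := ((h.hD (f' x)).comp x (h'.hf x)).mul (h'.hD x)
    refine this.congr_deriv ?_
    simp only [Function.comp]
    ring
  hu x := by
    have := (h'.hu x).add ((h'.hD x).mul ((h.hu (f' x)).comp x (h'.hf x)))
    refine this.congr_deriv ?_
    simp only [Function.comp]
    ring

theorem inv {f D u s k : ℝ → ℝ} (h : NJet f D u s) (hk : Continuous k) (hfk : ∀ x, f (k x) = x) :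
    NJet k (fun x => (D (k x))⁻¹) (fun x => - u (k x) * (D (k x))⁻¹)
      (fun x => - s (k x) * ((D (k x))⁻¹) ^ 2) := by
  have h1 : ∀ x, HasDerivAt k ((D (k x))⁻¹) x := fun x =>
    HasDerivAt.of_local_left_inverse hk.continuousAt (h.hf _) (h.pos _).ne'
      (Filter.Eventually.of_forall hfk)
  have h2 : ∀ x, HasDerivAt (fun x => (D (k x))⁻¹) ((D (k x))⁻¹ * (- u (k x) * (D (k x))⁻¹)) x := by
    intro x
    have := ((h.hD (k x)).comp x (h1 x)).inv (h.pos _).ne'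
    refine this.congr_deriv ?_
    have := (h.pos (k x)).ne'
    simp only [Function.comp]
    field_simp
  refine ⟨h1, fun x => inv_pos.2 (h.pos _), h2, fun x => ?_⟩
  have := ((h.hu (k x)).comp x (h1 x)).neg.mul (h2 x)
  refine this.congr_deriv ?_
  have := (h.pos (k x)).ne'
  simp only [Function.comp, Pi.neg_apply]
  field_simp
  ring

theorem shift {f D u s : ℝ → ℝ} (h : NJet f D u s) (a b : ℝ) :
    NJet (fun x => f (x + a) + b) (fun x => D (x + a)) (fun x => u (x + a))
      (fun x => s (x + a)) where
  hf x := by simpa using ((h.hf (x + a)).comp_add_const x a).add_const b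
  pos x := h.pos _
  hD x := by simpa using ((h.hD (x + a)).comp_add_const x a)
  hu x := by simpa using ((h.hu (x + a)).comp_add_const x a)

theorem refl {f D u s : ℝ → ℝ} (h : NJet f D u s) :
    NJet (fun x => - f (-x)) (fun x => D (-x)) (fun x => - u (-x)) (fun x => s (-x)) where
  hf x := by
    have := ((h.hf (-x)).comp x (hasDerivAt_neg x)).neg
    exact this.congr_deriv (by ring)
  pos x := h.pos _
  hD x := by
    have := ((h.hD (-x)).comp x (hasDerivAt_neg x))
    exact this.congr_deriv (by ring)
  hu x := by
    have := ((h.hu (-x)).comp x (hasDerivAt_neg x)).neg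
    exact this.congr_deriv (by ring)

theorem cont {f D u s : ℝ → ℝ} (h : NJet f D u s) : Continuous f :=
  continuous_iff_continuousAt.2 fun x => (h.hf x).continuousAt
theorem contD {f D u s : ℝ → ℝ} (h : NJet f D u s) : Continuous D :=
  continuous_iff_continuousAt.2 fun x => (h.hD x).continuousAt
theorem contu {f D u s : ℝ → ℝ} (h : NJet f D u s) : Continuous u :=
  continuous_iff_continuousAt.2 fun x => (h.hu x).continuousAt
theorem hlog {f D u s : ℝ → ℝ} (h : NJet f D u s) (x : ℝ) :
    HasDerivAt (fun x => Real.log (D x)) (u x) x := by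
  refine ((h.hD x).log (h.pos x).ne').congr_deriv ?_
  have := (h.pos x).ne'
  field_simp
theorem strictMono {f D u s : ℝ → ℝ} (h : NJet f D u s) : StrictMono f :=
  strictMono_of_hasDerivAt_pos h.hf h.pos

end NJet

/-- A group of iterates `G i`, `i ∈ ℤ`, of a lift of a circle diffeomorphism with jets. -/
structure NSys (G D u s : ℤ → ℝ → ℝ) (S : ℝ) : Prop where
  jet : ∀ i, NJet (G i) (D i) (u i) (s i)
  G0 : ∀ x, G 0 x = x
  Gadd : ∀ i j x, G (i + j) x = G i (G j x)
  Gper1 : ∀ i x, G i (x + 1) = G i x + 1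
  sbd : ∀ x, |s 1 x| ≤ S

namespace NSys
variable {G D u s : ℤ → ℝ → ℝ} {S : ℝ}

theorem refl (h : NSys G D u s S) :
    NSys (fun i x => - G i (-x)) (fun i x => D i (-x)) (fun i x => - u i (-x))
      (fun i x => s i (-x)) S where
  jet i := (h.jet i).refl
  G0 x := by simp [h.G0]
  Gadd i j x := by simp [h.Gadd]
  Gper1 i x := by
    have := h.Gper1 i (-(x + 1))
    have e : -(x + 1) + 1 = -x := by ring
    rw [e] at this
    linarith
  sbd x := h.sbd _

theorem Gper (h : NSys G D u s S) (i l : ℤ) (x : ℝ) : G i (x + l) = G i x + l := by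
  induction l using Int.induction_on with
  | zero => simp
  | succ k ih =>
    push_cast at ih ⊢
    rw [← add_assoc, h.Gper1, ih]; ring
  | pred k ih =>
    have := h.Gper1 i (x + ((-(k:ℤ) - 1 : ℤ) : ℝ))
    push_cast at ih this ⊢
    have e : x + (-(k:ℝ) - 1) + 1 = x + -(k:ℝ) := by ring
    rw [e, ih] at this
    linarith

theorem per1 (h : NSys G D u s S) (i : ℤ) (x : ℝ) :
    D i (x + 1) = D i x ∧ u i (x + 1) = u i x ∧ s i (x + 1) = s i x := by
  have h1 := (h.jet i).shift 1 (-1)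
  have e : (fun x => G i (x + 1) + (-1)) = G i := by funext y; rw [h.Gper1]; ring
  rw [e] at h1
  obtain ⟨a, b, c⟩ := h1.unique (h.jet i)
  exact ⟨congrFun a x, congrFun b x, congrFun c x⟩

theorem per (h : NSys G D u s S) (i l : ℤ) (x : ℝ) :
    D i (x + l) = D i x ∧ u i (x + l) = u i x ∧ s i (x + l) = s i x := by
  have h1 := (h.jet i).shift l (-l)
  have e : (fun x => G i (x + l) + (-l)) = G i := by funext y; rw [h.Gper]; ring
  rw [e] at h1
  obtain ⟨a, b, c⟩ := h1.unique (h.jet i)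
  exact ⟨congrFun a x, congrFun b x, congrFun c x⟩

theorem cocycle (h : NSys G D u s S) (i j : ℤ) (x : ℝ) :
    D (i + j) x = D i (G j x) * D j x ∧ u (i + j) x = u j x + D j x * u i (G j x) ∧
      s (i + j) x = s j x + D j x ^ 2 * s i (G j x) := by
  have h1 := (h.jet i).comp (h.jet j)
  have e : (fun x => G i (G j x)) = G (i + j) := by funext y; rw [h.Gadd]
  rw [e] at h1
  obtain ⟨a, b, c⟩ := (h.jet (i + j)).unique h1
  exact ⟨congrFun a x, congrFun b x, congrFun c x⟩

theorem zero (h : NSys G D u s S) (x : ℝ) : D 0 x = 1 ∧ u 0 x = 0 ∧ s 0 x = 0 := by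
  have e : G 0 = fun x => x := funext h.G0
  have h1 := h.jet 0
  rw [e] at h1
  obtain ⟨a, b, c⟩ := h1.unique NJet.id
  exact ⟨congrFun a x, congrFun b x, congrFun c x⟩

theorem logD_add (h : NSys G D u s S) (i j : ℤ) (x : ℝ) :
    Real.log (D (i + j) x) = Real.log (D i (G j x)) + Real.log (D j x) := by
  rw [(h.cocycle i j x).1, Real.log_mul ((h.jet i).pos _).ne' ((h.jet j).pos _).ne']

theorem Gcomm (h : NSys G D u s S) (i j : ℤ) (x : ℝ) : G i (G j x) = G j (G i x) := by
  rw [← h.Gadd, ← h.Gadd, add_comm]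

theorem Gneg (h : NSys G D u s S) (i : ℤ) (x : ℝ) : G i (G (-i) x) = x := by
  rw [← h.Gadd, add_neg_cancel, h.G0]

theorem Gneg' (h : NSys G D u s S) (i : ℤ) (x : ℝ) : G (-i) (G i x) = x := by
  rw [← h.Gadd, neg_add_cancel, h.G0]

theorem sumS (h : NSys G D u s S) (i : ℤ) (x : ℝ) :
    (0 ≤ i → |s i x| ≤ S * ∑ k ∈ Finset.Ico 0 i, D k x ^ 2) ∧
    (i ≤ 0 → |s i x| ≤ S * ∑ k ∈ Finset.Ico i 0, D k x ^ 2) := by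
  have key : ∀ k, |s (k + 1) x - s k x| ≤ S * D k x ^ 2 := by
    intro k
    have := (h.cocycle 1 k x).2.2
    rw [add_comm] at this
    rw [this, add_sub_cancel_left, abs_mul, abs_of_nonneg (sq_nonneg (D k x)), mul_comm]
    exact mul_le_mul_of_nonneg_right (h.sbd _) (sq_nonneg _)
  constructor
  · intro hi
    induction i, hi using Int.leInduction with
    | base => simp [(h.zero x).2.2]
    | succ k hk ih =>
      have e : Finset.Ico 0 (k + 1) = insert k (Finset.Ico 0 k) := by
        ext a; simp; omega
      rw [e, Finset.sum_insert (by simp), mul_add]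
      have := key k
      rw [abs_le] at *
      constructor <;> linarith
  · intro hi
    induction i, hi using Int.leInductionDown with
    | base => simp [(h.zero x).2.2]
    | pred k hk ih =>
      have e : Finset.Ico (k - 1) 0 = insert (k - 1) (Finset.Ico k 0) := by
        ext a; simp; omega
      rw [e, Finset.sum_insert (by simp), mul_add]
      have := key (k - 1)
      rw [sub_add_cancel] at this
      rw [abs_le] at *
      constructor <;> linarith

end NSys

theorem nsum_disjoint {ι : Type*} [DecidableEq ι] (F : Finset ι) (L R : ι → ℝ) (Q : ℝ → ℝ)
    (hQ : Monotone Q) (lo : ℝ) (hL : ∀ i ∈ F, lo ≤ L i) (hLR : ∀ i ∈ F, L i < R i)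
    (hdis : ∀ i ∈ F, ∀ j ∈ F, i ≠ j → R i ≤ L j ∨ R j ≤ L i) :
    ∀ hi, lo ≤ hi → (∀ i ∈ F, R i ≤ hi) → ∑ i ∈ F, (Q (R i) - Q (L i)) ≤ Q hi - Q lo := by
  induction F using Finset.induction_on_max_value L with
  | empty => intro hi h _; simpa using hQ h
  | insert a F ha hmax ih =>
    intro hi hlo hR
    rw [Finset.sum_insert ha]
    have h1 := ih (fun i hi => hL i (Finset.mem_insert_of_mem hi))
      (fun i hi => hLR i (Finset.mem_insert_of_mem hi))
      (fun i hi j hj => hdis i (Finset.mem_insert_of_mem hi) j (Finset.mem_insert_of_mem hj))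
      (L a) (hL a (Finset.mem_insert_self _ _)) (by
        intro i hiF
        rcases hdis i (Finset.mem_insert_of_mem hiF) a (Finset.mem_insert_self _ _)
          (by rintro rfl; exact ha hiF) with h | h
        · exact h
        · have := hmax i hiF
          have := hLR a (Finset.mem_insert_self _ _)
          linarith)
    have h2 := hQ (hR a (Finset.mem_insert_self _ _))
    linarith

theorem nper_int {Q : ℝ → ℝ} {C : ℝ} (h : ∀ x, Q (x + 1) = Q x + C) (l : ℤ) (x : ℝ) :
    Q (x + l) = Q x + l * C := by
  induction l using Int.induction_on with
  | zero => simp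
  | succ k ih =>
    push_cast at ih ⊢
    rw [← add_assoc, h, ih]; ring
  | pred k ih =>
    have := h (x + ((-(k:ℤ) - 1 : ℤ) : ℝ))
    push_cast at ih this ⊢
    have e : x + (-(k:ℝ) - 1) + 1 = x + -(k:ℝ) := by ring
    rw [e, ih] at this
    linarith

/-- All the data used in the core estimate. -/
structure NCore (G D u s : ℤ → ℝ → ℝ) (S V M m β : ℝ) (Qp Qm T : ℝ → ℝ) (a p b p' q : ℤ) :
    Prop where
  sys : NSys G D u s S
  S0 : 0 ≤ S
  V0 : 0 ≤ V
  QpM : Monotone Qp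
  QmM : Monotone Qm
  Qp1 : ∀ x, Qp (x + 1) = Qp x + V / 2
  Qm1 : ∀ x, Qm (x + 1) = Qm x + V / 2
  QpF : ∀ x y, x ≤ y → Real.log (D 1 y) - Real.log (D 1 x) ≤ Qp y - Qp x
  QmF : ∀ x y, x ≤ y → Real.log (D 1 x) - Real.log (D 1 y) ≤ Qm y - Qm x
  sgn1 : ∀ (k l : ℤ) x, k * β < l → G k x < x + l
  sgn2 : ∀ (k l : ℤ) x, l < k * β → x + l < G k x
  sgn1w : ∀ (k l : ℤ) x, k * β ≤ l → G k x ≤ x + l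
  sgn2w : ∀ (k l : ℤ) x, l ≤ k * β → x + l ≤ G k x
  d0 : 0 < a * β - p
  d1 : a * β - p < 1
  b0 : b * β - p' < 0
  bs : 0 < a * β - p + (b * β - p')
  ab : (1 ≤ a ∧ a ≤ q ∧ b = q) ∨ (a ≤ -1 ∧ -a ≤ q ∧ b = -q)
  best : ∀ d l : ℤ, 0 < d → d < q → a * β - p ≤ |d * β - l|
  hT : ∀ x, T x = G a x - p
  m0 : 0 < m
  hm : ∀ x, m ≤ T x - x
  hM : ∀ x, T x - x ≤ M

namespace NCore
variable {G D u s : ℤ → ℝ → ℝ} {S V M m β : ℝ} {Qp Qm T : ℝ → ℝ} {a p b p' q : ℤ}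

theorem q1 (h : NCore G D u s S V M m β Qp Qm T a p b p' q) : 1 ≤ q := by
  rcases h.ab with h | h <;> omega

theorem ltT (h : NCore G D u s S V M m β Qp Qm T a p b p' q) (x : ℝ) : x < T x := by
  have := h.hm x; have := h.m0; linarith

theorem Tlt (h : NCore G D u s S V M m β Qp Qm T a p b p' q) (x : ℝ) : T x < x + 1 := by
  have := h.sgn1 a (p + 1) x (by push_cast; linarith [h.d1])
  rw [h.hT]; push_cast at this; linarith

theorem M0 (h : NCore G D u s S V M m β Qp Qm T a p b p' q) : 0 < M := by
  have := h.hm 0; have := h.hM 0; have := h.m0; linarith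

theorem TG (h : NCore G D u s S V M m β Qp Qm T a p b p' q) (i : ℤ) (x : ℝ) :
    T (G i x) = G i (T x) := by
  rw [h.hT, h.hT, h.sys.Gcomm, sub_eq_add_neg (G a x), ← Int.cast_neg, h.sys.Gper]
  push_cast; ring

theorem Tint (h : NCore G D u s S V M m β Qp Qm T a p b p' q) (l : ℤ) (x : ℝ) :
    T (x + l) = T x + l := by
  rw [h.hT, h.hT, h.sys.Gper]; ring

theorem disj (h : NCore G D u s S V M m β Qp Qm T a p b p' q) (d l : ℤ) (hd : 0 < d) (hdq : d < q) :
    (∀ x, T x ≤ G d x - l) ∨ (∀ x, T (G d x) - l ≤ x) := by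
  rcases le_abs.1 (h.best d l hd hdq) with h1 | h1
  · left
    intro x
    have := h.sgn2w (d - a) (l - p) (G a x) (by push_cast; linarith)
    rw [← h.sys.Gadd, sub_add_cancel] at this
    push_cast at this
    rw [h.hT]; linarith
  · right
    intro x
    have := h.sgn1w (a + d) (p + l) x (by push_cast; linarith)
    rw [h.sys.Gadd] at this
    push_cast at this
    rw [h.hT]; linarith

theorem wsum (h : NCore G D u s S V M m β Qp Qm T a p b p' q) {Q : ℝ → ℝ} {C : ℝ}
    (hQ : Monotone Q) (hQ1 : ∀ x, Q (x + 1) = Q x + C) (A B : ℤ) (hB : B ≤ A + q) (c : ℝ) :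
    ∑ i ∈ Finset.Ico A B, (Q (T (G i c)) - Q (G i c)) ≤ C := by
  set n : ℤ → ℤ := fun i => ⌊G i c - G A c⌋ with hn
  have hn0 : ∀ i, (n i : ℝ) ≤ G i c - G A c := fun i => Int.floor_le _
  have hn1 : ∀ i, G i c - G A c < n i + 1 := fun i => Int.lt_floor_add_one _
  have hnA : n A = 0 := by simp [hn]
  have key := nsum_disjoint (Finset.Ico A B) (fun i => G i c + ((-n i : ℤ) : ℝ))
    (fun i => T (G i c) + ((-n i : ℤ) : ℝ)) Q hQ (G A c)
    (by intro i _; have := hn0 i; push_cast; linarith)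
    (by intro i _; have := h.ltT (G i c); push_cast; linarith)
    (by
      have aux : ∀ i j : ℤ, i < j → j < i + q →
          (T (G i c) + ((-n i : ℤ) : ℝ) ≤ G j c + ((-n j : ℤ) : ℝ) ∨
            T (G j c) + ((-n j : ℤ) : ℝ) ≤ G i c + ((-n i : ℤ) : ℝ)) := by
        intro i j hij hj
        have e : G (j - i) (G i c) = G j c := by rw [← h.sys.Gadd, sub_add_cancel]
        rcases h.disj (j - i) (n j - n i) (by omega) (by omega) with h1 | h1
        · left
          have := h1 (G i c)
          rw [e] at this; push_cast at this ⊢; linarith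
        · right
          have := h1 (G i c)
          rw [e] at this; push_cast at this ⊢; linarith
      intro i hi j hj hij
      rw [Finset.mem_Ico] at hi hj
      rcases lt_or_gt_of_ne hij with h1 | h1
      · exact aux i j h1 (by omega)
      · exact (aux j i h1 (by omega)).symm)
    (G A c + 1) (by linarith)
    (by
      intro i hi
      rw [Finset.mem_Ico] at hi
      rcases eq_or_lt_of_le hi.1 with h1 | h1
      · subst h1
        rw [hnA]; have := h.Tlt (G A c); push_cast; linarith
      · have e : G (i - A) (G A c) = G i c := by rw [← h.sys.Gadd, sub_add_cancel]
        rcases h.disj (i - A) (n i + 1) (by omega) (by omega) with h2 | h2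
        · have h3 := h2 (G A c)
          rw [e] at h3
          have := h.ltT (G A c)
          have := hn1 i
          push_cast at h3; linarith
        · have h3 := h2 (G A c)
          rw [e] at h3
          push_cast at h3 ⊢; linarith)
  rw [hQ1, add_sub_cancel_left] at key
  refine le_trans (le_of_eq ?_) key
  refine Finset.sum_congr rfl fun i _ => ?_
  rw [nper_int hQ1, nper_int hQ1]
  ring

theorem logD_tele (h : NCore G D u s S V M m β Qp Qm T a p b p' q) (A B : ℤ) (hAB : A ≤ B) (y : ℝ) :
    Real.log (D B y) - Real.log (D A y) = ∑ k ∈ Finset.Ico A B, Real.log (D 1 (G k y)) := by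
  induction B, hAB using Int.leInduction with
  | base => simp
  | succ k hk ih =>
    have e : Finset.Ico A (k + 1) = insert k (Finset.Ico A k) := by
      ext a; simp; omega
    rw [e, Finset.sum_insert (by simp), ← ih, add_comm k 1, h.sys.logD_add]
    ring

theorem dist0 (h : NCore G D u s S V M m β Qp Qm T a p b p' q) (A B : ℤ) (hAB : A ≤ B)
    (hB : B ≤ A + q) (c y z : ℝ) (hy : y ∈ Set.Icc c (T c)) (hz : z ∈ Set.Icc c (T c)) :
    (Real.log (D B y) - Real.log (D A y)) - (Real.log (D B z) - Real.log (D A z)) ≤ V / 2 := by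
  have hG : ∀ k, Monotone (G k) := fun k => (h.sys.jet k).strictMono.monotone
  rw [h.logD_tele A B hAB, h.logD_tele A B hAB, ← Finset.sum_sub_distrib]
  rcases le_total z y with hzy | hzy
  · refine le_trans (Finset.sum_le_sum fun k _ => ?_) (h.wsum h.QpM h.Qp1 A B hB c)
    have h1 := h.QpF _ _ (hG k hzy)
    have h2 := h.QpM (hG k hy.2)
    have h3 := h.QpM (hG k hz.1)
    rw [h.TG]
    linarith
  · refine le_trans (Finset.sum_le_sum fun k _ => ?_) (h.wsum h.QmM h.Qm1 A B hB c)
    have h1 := h.QmF _ _ (hG k hzy)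
    have h2 := h.QmM (hG k hz.2)
    have h3 := h.QmM (hG k hy.1)
    rw [h.TG]
    linarith

theorem logD0 (h : NCore G D u s S V M m β Qp Qm T a p b p' q) (y : ℝ) : Real.log (D 0 y) = 0 := by
  rw [(h.sys.zero y).1, Real.log_one]

theorem dist1 (h : NCore G D u s S V M m β Qp Qm T a p b p' q) (i : ℤ) (hi : -q ≤ i) (hi' : i ≤ q)
    (c y z : ℝ) (hy : y ∈ Set.Icc c (T c)) (hz : z ∈ Set.Icc c (T c)) :
    Real.log (D i y) - Real.log (D i z) ≤ V / 2 := by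
  rcases le_total 0 i with h0 | h0
  · have := h.dist0 0 i h0 (by omega) c y z hy hz
    rw [h.logD0, h.logD0] at this
    linarith
  · have := h.dist0 i 0 h0 (by omega) c z y hz hy
    rw [h.logD0, h.logD0] at this
    linarith

theorem dist2 (h : NCore G D u s S V M m β Qp Qm T a p b p' q) (i : ℤ) (hi : 0 ≤ i) (hi' : i ≤ 2 * q)
    (c y z : ℝ) (hy : y ∈ Set.Icc c (T c)) (hz : z ∈ Set.Icc c (T c)) :
    Real.log (D i y) - Real.log (D i z) ≤ V := by
  have := h.q1
  have := h.V0
  rcases le_total i q with h0 | h0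
  · have := h.dist1 i (by omega) h0 c y z hy hz
    linarith
  · have h1 := h.dist1 q (by omega) le_rfl c y z hy hz
    have h2 := h.dist0 q i h0 (by omega) c y z hy hz
    linarith

theorem window (h : NCore G D u s S V M m β Qp Qm T a p b p' q) (A B : ℤ) (hB : B ≤ A + q) (W : ℝ)
    (c z : ℝ)
    (hW : ∀ i ∈ Finset.Ico A B, ∀ y ∈ Set.Icc c (T c), Real.log (D i z) - Real.log (D i y) ≤ W) :
    S * ∑ i ∈ Finset.Ico A B, D i z ^ 2 ≤ S * M * Real.exp W ^ 2 / (T c - c) ^ 2 := by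
  have hℓ : 0 < T c - c := by linarith [h.ltT c]
  have h1 : ∀ i ∈ Finset.Ico A B, D i z ^ 2 ≤
      (Real.exp W ^ 2 * M / (T c - c) ^ 2) * (T (G i c) - G i c) := by
    intro i hi
    obtain ⟨y, hy, hy2⟩ := exists_hasDerivAt_eq_slope (G i) (D i) (h.ltT c)
      (h.sys.jet i).cont.continuousOn (fun x _ => (h.sys.jet i).hf x)
    have h2 := hW i hi y ⟨hy.1.le, hy.2.le⟩
    have pz := (h.sys.jet i).pos z
    have py := (h.sys.jet i).pos y
    have h3 : D i z ≤ Real.exp W * D i y := by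
      have : Real.log (D i z) ≤ W + Real.log (D i y) := by linarith
      rw [Real.log_le_iff_le_exp pz, Real.exp_add, Real.exp_log py] at this
      exact this
    rw [← h.TG] at hy2
    have hJ : 0 < T (G i c) - G i c := by linarith [h.ltT (G i c)]
    have hJM := h.hM (G i c)
    calc D i z ^ 2 ≤ (Real.exp W * D i y) ^ 2 := by gcongr
      _ = (Real.exp W ^ 2 / (T c - c) ^ 2) * (T (G i c) - G i c) * (T (G i c) - G i c) := by
          rw [hy2]; field_simp
      _ ≤ (Real.exp W ^ 2 / (T c - c) ^ 2) * M * (T (G i c) - G i c) := by gcongr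
      _ = _ := by ring
  have h4 : ∑ i ∈ Finset.Ico A B, (T (G i c) - G i c) ≤ 1 :=
    h.wsum (Q := fun x => x) monotone_id (fun x => rfl) A B hB c
  have h5 := Finset.sum_le_sum h1
  rw [← Finset.mul_sum] at h5
  have h6 : 0 ≤ Real.exp W ^ 2 * M / (T c - c) ^ 2 := by have := h.M0; positivity
  calc S * ∑ i ∈ Finset.Ico A B, D i z ^ 2
      ≤ S * (Real.exp W ^ 2 * M / (T c - c) ^ 2 * 1) := by
        refine mul_le_mul_of_nonneg_left (h5.trans ?_) h.S0
        exact mul_le_mul_of_nonneg_left h4 h6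
    _ = _ := by ring

theorem window1 (h : NCore G D u s S V M m β Qp Qm T a p b p' q) (A B : ℤ) (hA : A ≤ 0) (hB0 : 0 ≤ B)
    (hB : B ≤ A + q)  (c z : ℝ) (hz : z ∈ Set.Icc c (T c)) :
    S * ∑ i ∈ Finset.Ico A B, D i z ^ 2 ≤ S * M * Real.exp V / (T c - c) ^ 2 := by
  have := h.window A B hB (V / 2) c z (by
    intro i hi y hy
    rw [Finset.mem_Ico] at hi
    exact h.dist1 i (by omega) (by omega) c z y hz hy)
  rw [← Real.exp_nat_mul] at this
  convert this using 4
  push_cast; ring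

theorem s_split (h : NCore G D u s S V M m β Qp Qm T a p b p' q) (i r : ℤ) (hi : 0 ≤ i) (hr : 0 ≤ r)
    (hq : i + r ≤ q) (c z : ℝ) (hz : z ∈ Set.Icc c (T c)) :
    |s i z| + |s (-r) z| ≤ S * M * Real.exp V / (T c - c) ^ 2 := by
  refine le_trans ?_ (h.window1 (-r) i (by omega) hi (by omega) c z hz)
  have h1 := (h.sys.sumS i z).1 hi
  have h2 := (h.sys.sumS (-r) z).2 (by omega)
  have e : Finset.Ico (-r) i = Finset.Ico (-r) 0 ∪ Finset.Ico 0 i := by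
    ext k; simp; omega
  rw [e, Finset.sum_union, mul_add]
  · linarith
  · rw [Finset.disjoint_left]; intro k; simp; omega

theorem s_a (h : NCore G D u s S V M m β Qp Qm T a p b p' q) (c z : ℝ) (hz : z ∈ Set.Icc c (T c)) :
    |s a z| ≤ S * M * Real.exp V / (T c - c) ^ 2 := by
  rcases h.ab with h1 | h1
  · have := h.s_split a 0 (by omega) le_rfl (by omega) c z hz
    exact le_trans (le_add_of_nonneg_right (abs_nonneg _)) this
  · have := h.s_split 0 (-a) le_rfl (by omega) (by omega) c z hz
    have := abs_nonneg (s 0 z)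
    rw [neg_neg] at *
    linarith

theorem s_two (h : NCore G D u s S V M m β Qp Qm T a p b p' q) (j : ℤ) (hj : 0 ≤ j) (hj2 : j ≤ 2 * q)
    (c z : ℝ) (hz : z ∈ Set.Icc c (T c)) :
    |s j z| ≤ S * M * Real.exp V / (T c - c) ^ 2 + S * M * Real.exp V ^ 2 / (T c - c) ^ 2 := by
  have hM := h.M0
  have hS := h.S0
  have hl : 0 < T c - c := by linarith [h.ltT c]
  rcases le_total j q with h0 | h0
  · have h1 := h.s_split j 0 hj le_rfl (by omega) c z hz
    have h2 := le_trans (le_add_of_nonneg_right (abs_nonneg _)) h1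
    have : 0 ≤ S * M * Real.exp V ^ 2 / (T c - c) ^ 2 := by positivity
    linarith
  · have hq := h.q1
    have h1 := h.window1 0 q le_rfl (by omega) (by omega) c z hz
    have h2 := h.window q j (by omega) V c z (by
      intro i hi y hy
      rw [Finset.mem_Ico] at hi
      exact h.dist2 i (by omega) (by omega) c z y hz hy)
    have h3 := (h.sys.sumS j z).1 hj
    have e : Finset.Ico 0 j = Finset.Ico 0 q ∪ Finset.Ico q j := by
      ext k; simp; omega
    rw [e, Finset.sum_union, mul_add] at h3
    · linarith
    · rw [Finset.disjoint_left]; intro k; simp; omega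

end NCore

theorem ncov_pos (G : ℤ → ℝ → ℝ) (T R : ℝ → ℝ) (a p p' q : ℤ)
    (Gadd : ∀ i j x, G (i + j) x = G i (G j x))
    (G0 : ∀ x, G 0 x = x)
    (Gper : ∀ (i l : ℤ) x, G i (x + l) = G i x + l)
    (hG : ∀ i, StrictMono (G i))
    (ha : 1 ≤ a) (haq : a ≤ q)
    (hT : ∀ x, T x = G a x - p) (hR : ∀ x, R x = G q x - p')
    (ltT : ∀ x, x < T x) (Rlt : ∀ x, R x < x) (TR : ∀ x, x < T (R x)) (x y : ℝ) :
    ∃ (i r l1 l2 : ℤ) (c : ℝ), 0 ≤ i ∧ 0 ≤ r ∧ i + r ≤ q ∧ y ∈ Set.Icc c (T c) ∧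
      G i x + l1 ∈ Set.Icc c (T c) ∧ G (-r) x + l2 ∈ Set.Icc c (T c) := by
  set n : ℤ → ℤ := fun k => ⌊y - G k x⌋ with hn
  have hle : ∀ k, G k x + n k ≤ y := fun k => by
    have : (n k : ℝ) ≤ y - G k x := Int.floor_le _
    linarith
  have hmaxn : ∀ k (l : ℤ), G k x + l ≤ y → G k x + l ≤ G k x + n k := fun k l hl => by
    have : l ≤ n k := Int.le_floor.2 (by linarith)
    have : (l : ℝ) ≤ n k := by exact_mod_cast this
    linarith
  have Tint : ∀ (l : ℤ) x, T (x + l) = T x + l := fun l x => by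
    rw [hT, hT, Gper]; ring
  obtain ⟨k, hk, hkmax⟩ := Finset.exists_max_image (Finset.Ico (-a) q) (fun k => G k x + n k)
    ⟨0, by simp; omega⟩
  rw [Finset.mem_Ico] at hk
  have hTk : ∀ k, T (G k x + n k) = G (k + a) x + ((n k - p : ℤ) : ℝ) := by
    intro k
    rw [Tint, hT, ← Gadd, add_comm a k]; push_cast; ring
  have hRi : ∀ k, R (G (k - q) x + ((n k + p' : ℤ) : ℝ)) = G k x + n k := by
    intro k
    rw [hR, Gper, ← Gadd, add_sub_cancel]; push_cast; ring
  have hRk1 : G k x + n k < G (k - q) x + ((n k + p' : ℤ) : ℝ) := by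
    have := Rlt (G (k - q) x + ((n k + p' : ℤ) : ℝ))
    rwa [hRi] at this
  have hRk2 : G (k - q) x + ((n k + p' : ℤ) : ℝ) < T (G k x + n k) := by
    have := TR (G (k - q) x + ((n k + p' : ℤ) : ℝ))
    rwa [hRi] at this
  have hy : y ≤ T (G k x + n k) := by
    by_contra hcon
    push Not at hcon
    by_cases h1 : k + a < q
    · have h2 := hkmax (k + a) (by rw [Finset.mem_Ico]; omega)
      have h3 := ltT (G k x + n k)
      rw [hTk] at h3 hcon
      have h4 := hmaxn _ _ hcon.le
      linarith
    · have h2 := hkmax (k - q) (by rw [Finset.mem_Ico]; omega)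
      have h4 := hmaxn (k - q) (n k + p') (by linarith)
      linarith
  by_cases hk0 : 0 ≤ k
  · refine ⟨k, q - k, n k, n k + p', G k x + n k, hk0, by omega, by omega, ⟨hle k, hy⟩, ?_, ?_⟩
    · exact ⟨le_rfl, (ltT _).le⟩
    · rw [neg_sub]
      exact ⟨hRk1.le, hRk2.le⟩
  · refine ⟨k + a, -k, n k - p, n k, G k x + n k, by omega, by omega, by omega, ⟨hle k, hy⟩, ?_, ?_⟩
    · rw [← hTk]
      exact ⟨(ltT _).le, le_rfl⟩
    · rw [neg_neg]
      exact ⟨le_rfl, (ltT _).le⟩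

namespace NCore
variable {G D u s : ℤ → ℝ → ℝ} {S V M m β : ℝ} {Qp Qm T : ℝ → ℝ} {a p b p' q : ℤ}

theorem cov (h : NCore G D u s S V M m β Qp Qm T a p b p' q) (x y : ℝ) :
    ∃ (i r l1 l2 : ℤ) (c : ℝ), 0 ≤ i ∧ 0 ≤ r ∧ i + r ≤ q ∧ y ∈ Set.Icc c (T c) ∧
      G i x + l1 ∈ Set.Icc c (T c) ∧ G (-r) x + l2 ∈ Set.Icc c (T c) := by
  have hR : ∀ x, G b x - p' < x := fun x => by
    have := h.sgn1 b p' x (by linarith [h.b0]); linarith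
  have hTR : ∀ x, x < T (G b x - p') := fun x => by
    have h1 := h.sgn2 (a + b) (p + p') x (by push_cast; linarith [h.bs])
    have h2 := h.Tint (-p') (G b x)
    push_cast at h1 h2
    rw [sub_eq_add_neg, h2, h.hT, ← h.sys.Gadd]; linarith
  rcases h.ab with ⟨h1, h2, h3⟩ | ⟨h1, h2, h3⟩
  · subst h3
    exact ncov_pos G T (fun x => G b x - p') a p p' b h.sys.Gadd h.sys.G0 h.sys.Gper
      (fun i => (h.sys.jet i).strictMono) h1 h2 h.hT (fun _ => rfl) h.ltT hR hTR x y
  · obtain ⟨i, r, l1, l2, c, e1, e2, e3, e4, e5, e6⟩ :=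
      ncov_pos (fun i => G (-i)) T (fun x => G b x - p') (-a) p p' q
      (fun i j x => by rw [← h.sys.Gadd]; congr 1; ring)
      (fun x => by simpa using h.sys.G0 x) (fun i l x => h.sys.Gper _ _ _)
      (fun i => (h.sys.jet _).strictMono) (by omega) h2 (by simpa using h.hT)
      (fun _ => by rw [h3]) h.ltT hR hTR x y
    refine ⟨r, i, l2, l1, c, e2, e1, by omega, e4, ?_, e5⟩
    simpa using e6

end NCore

theorem nmvt {f f' : ℝ → ℝ} (hf : ∀ x, HasDerivAt f (f' x) x) (x y : ℝ) :
    ∃ ξ ∈ Set.uIcc x y, f y - f x = f' ξ * (y - x) := by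
  rcases lt_trichotomy x y with h | h | h
  · obtain ⟨ξ, h1, h2⟩ := exists_hasDerivAt_eq_slope f f' h
      (fun x _ => (hf x).continuousAt.continuousWithinAt) (fun x _ => hf x)
    refine ⟨ξ, Set.mem_uIcc.2 (Or.inl ⟨h1.1.le, h1.2.le⟩), ?_⟩
    rw [h2]; field_simp [(sub_pos.2 h).ne']
  · subst h; exact ⟨x, by simp, by simp⟩
  · obtain ⟨ξ, h1, h2⟩ := exists_hasDerivAt_eq_slope f f' h
      (fun x _ => (hf x).continuousAt.continuousWithinAt) (fun x _ => hf x)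
    refine ⟨ξ, Set.mem_uIcc.2 (Or.inr ⟨h1.1.le, h1.2.le⟩), ?_⟩
    rw [h2]; field_simp [(sub_pos.2 h).ne']
    ring

theorem nper_max {f : ℝ → ℝ} (hf : Continuous f) (hper : ∀ (l : ℤ) x, f (x + l) = f x) :
    ∃ y, ∀ x, f x ≤ f y := by
  obtain ⟨y, _, hy⟩ := isCompact_Icc.exists_isMaxOn (s := Set.Icc (0:ℝ) 1) ⟨0, by simp⟩
    hf.continuousOn
  refine ⟨y, fun x => ?_⟩
  have h1 : f x = f (Int.fract x) := by
    have := hper (⌊x⌋) (Int.fract x)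
    rwa [Int.fract_add_floor] at this
  rw [h1]
  exact hy ⟨Int.fract_nonneg x, (Int.fract_lt_one x).le⟩

theorem nexp_bound {v : ℝ} (hv : 0 ≤ v) : 4 * v < 1.17 * (1 + Real.exp v) := by
  have h1 : 3.48 ≤ Real.exp 1.25 := by
    have e : Real.exp 1.25 = Real.exp 1 * Real.exp 0.25 := by rw [← Real.exp_add]; norm_num
    have h2 := Real.quadratic_le_exp_of_nonneg (x := 0.25) (by norm_num)
    have h3 := Real.exp_one_gt_d9
    rw [e]
    calc (3.48:ℝ) ≤ 2.718 * 1.28125 := by norm_num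
      _ ≤ _ := by
        apply mul_le_mul _ _ (by norm_num) (by positivity)
        · linarith
        · norm_num at h2 ⊢; linarith
  have h4 : Real.exp v = Real.exp 1.25 * Real.exp (v - 1.25) := by rw [← Real.exp_add]; ring_nf
  have h5 := Real.add_one_le_exp (v - 1.25)
  have h6 := Real.add_one_le_exp v
  rcases le_total v 0.25 with h7 | h7
  · linarith
  · have : 3.48 * (v - 0.25) ≤ Real.exp v := by
      rw [h4]
      apply mul_le_mul h1 (by linarith) (by linarith) (by positivity)
    linarith

theorem node {w L sj : ℝ → ℝ} {x0 x1 K1 V m : ℝ} (h01 : x0 < x1)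
    (hL : ∀ t, HasDerivAt L (w t) t) (hL0 : L x0 = 0)
    (hw : ∀ t, HasDerivAt w (w t ^ 2 / 2 + sj t) t) (hK : 0 ≤ K1) (hV : 0 ≤ V)
    (hs : ∀ t ∈ Set.Icc x0 x1, -(K1 * (1 + Real.exp V)) ≤ sj t)
    (hLV : ∀ t ∈ Set.Icc x0 x1, L t ≤ V)
    (hU : 0 < w x0) (hU2 : 2 * (K1 * Real.exp V) < w x0 ^ 2)
    (hm : 0 < m) (hmx : m ≤ x1 - x0)
    (hΛ : L x1 ≤ K1 * m ^ 2 / 2 + (x1 - x0) * Real.sqrt K1) : False := by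
  set E := Real.exp V with hE
  have hE1 : 1 ≤ E := Real.one_le_exp hV
  set Φ : ℝ → ℝ := fun t => (2 * (K1 * (1 + E)) - w t ^ 2) * Real.exp (-L t) with hΦ
  have hwc : Continuous w := continuous_iff_continuousAt.2 fun x => (hw x).continuousAt
  have hLc : Continuous L := continuous_iff_continuousAt.2 fun x => (hL x).continuousAt
  have dΦ : ∀ t, HasDerivAt Φ (-2 * w t * Real.exp (-L t) * (sj t + K1 * (1 + E))) t := by
    intro t
    have := (((hw t).pow 2).const_sub (2 * (K1 * (1 + E)))).mul ((hL t).neg.exp)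
    refine this.congr_deriv ?_
    simp
    ring
  have anti : ∀ y ∈ Set.Icc x0 x1, (∀ t ∈ Set.Ico x0 y, 0 < w t) → Φ y ≤ Φ x0 := by
    intro y hy hpos
    have hA : AntitoneOn Φ (Set.Icc x0 y) := by
      apply antitoneOn_of_deriv_nonpos (convex_Icc _ _)
      · exact fun x _ => (dΦ x).continuousAt.continuousWithinAt
      · exact fun x _ => (dΦ x).differentiableAt.differentiableWithinAt
      · intro x hx
        rw [interior_Icc] at hx
        rw [(dΦ x).deriv]
        have h1 := hpos x ⟨hx.1.le, hx.2⟩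
        have h2 := hs x ⟨hx.1.le, hx.2.le.trans hy.2⟩
        have h3 : 0 ≤ w x * Real.exp (-L x) * (sj x + K1 * (1 + E)) := by
          have : 0 ≤ sj x + K1 * (1 + E) := by linarith
          positivity
        linarith
    exact hA ⟨le_rfl, hy.1⟩ ⟨hy.1, le_rfl⟩ hy.1
  have Φ0 : Φ x0 < 2 * K1 := by
    simp only [hΦ, hL0]; simp; linarith
  have hposw : ∀ t ∈ Set.Icc x0 x1, 0 < w t := by
    intro t ht
    by_contra hcon
    push Not at hcon
    have ivt : ∀ y ∈ Set.Icc x0 x1, w y ≤ 0 → ∃ z ∈ Set.Icc x0 y, w z = 0 := by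
      intro y hy hy0
      have := intermediate_value_Icc' hy.1 hwc.continuousOn (f := w)
      exact this ⟨hy0, hU.le⟩
    obtain ⟨z, hz, hz0⟩ := ivt t ht hcon
    have hcomp : IsCompact (Set.Icc x0 x1 ∩ {y | w y = 0}) :=
      isCompact_Icc.inter_right (isClosed_eq hwc continuous_const)
    obtain ⟨y, hy, hmin⟩ := hcomp.exists_isLeast ⟨z, ⟨hz.1, hz.2.trans ht.2⟩, hz0⟩
    have h1 := anti y hy.1 (by
      intro t' ht'
      by_contra hc
      push Not at hc
      obtain ⟨z', hz', hz0'⟩ := ivt t' ⟨ht'.1, ht'.2.le.trans hy.1.2⟩ hc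
      have := hmin ⟨⟨hz'.1, hz'.2.trans (ht'.2.le.trans hy.1.2)⟩, hz0'⟩
      linarith [hz'.2, ht'.2])
    have h2 : Φ y = 2 * (K1 * (1 + E)) * Real.exp (-L y) := by
      simp only [hΦ]; rw [hy.2]; ring
    have h3 : E⁻¹ ≤ Real.exp (-L y) := by
      rw [hE, ← Real.exp_neg]; exact Real.exp_le_exp.2 (by linarith [hLV y hy.1])
    have h4 : 2 * K1 ≤ 2 * (K1 * (1 + E)) * E⁻¹ := by
      have : 2 * (K1 * (1 + E)) * E⁻¹ = 2 * K1 * E⁻¹ + 2 * K1 := by field_simp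
      rw [this]
      have : 0 ≤ 2 * K1 * E⁻¹ := by positivity
      linarith
    have h5 : 2 * (K1 * (1 + E)) * E⁻¹ ≤ 2 * (K1 * (1 + E)) * Real.exp (-L y) := by gcongr
    linarith
  have hw2 : ∀ t ∈ Set.Icc x0 x1, 2 * K1 * (1 + E - Real.exp (L t)) < w t ^ 2 := by
    intro t ht
    have h1 := (anti t ht fun t' ht' => hposw t' ⟨ht'.1, ht'.2.le.trans ht.2⟩).trans_lt Φ0
    simp only [hΦ] at h1
    rw [Real.exp_neg, ← div_eq_mul_inv, div_lt_iff₀ (Real.exp_pos _)] at h1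
    nlinarith
  set κ := Real.sqrt K1 with hκ
  have hκ0 : 0 ≤ κ := Real.sqrt_nonneg _
  have hκ2 : K1 = κ ^ 2 := (Real.sq_sqrt hK).symm
  set ρ := Real.sqrt 2 with hρ
  have hρ0 : 0 < ρ := by positivity
  have hρ2 : ρ ^ 2 = 2 := Real.sq_sqrt (by norm_num)
  have hρl : 1.414 < ρ := Real.lt_sqrt_of_sq_lt (by norm_num)
  have hρu : ρ < 1.415 := by rw [hρ, Real.sqrt_lt' (by norm_num)]; norm_num
  have hLpos : ∀ t ∈ Set.Icc x0 x1, 0 ≤ L t := by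
    intro t ht
    obtain ⟨ξ, h1, h2⟩ := nmvt hL x0 t
    rw [Set.uIcc_of_le ht.1] at h1
    have := hposw ξ ⟨h1.1, h1.2.trans ht.2⟩
    rw [hL0] at h2
    have : 0 ≤ w ξ * (t - x0) := mul_nonneg this.le (by linarith [ht.1])
    linarith
  set ℓ := x1 - x0 with hℓ
  have hℓ0 : 0 < ℓ := sub_pos.2 h01
  have hΛ1 : ρ * κ * ℓ < L x1 := by
    obtain ⟨ξ, h1, h2⟩ := nmvt hL x0 x1
    rw [Set.uIcc_of_le h01.le] at h1
    have h3 := hw2 ξ h1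
    have h4 : Real.exp (L ξ) ≤ E := Real.exp_le_exp.2 (hLV ξ h1)
    have h5 : (ρ * κ) ^ 2 < w ξ ^ 2 := by
      rw [mul_pow, hρ2, ← hκ2]
      have : 0 ≤ 2 * K1 * (E - Real.exp (L ξ)) := by
        have : 0 ≤ E - Real.exp (L ξ) := by linarith
        positivity
      linarith
    have h6 := lt_of_pow_lt_pow_left₀ 2 (hposw ξ h1).le h5
    rw [hL0, sub_zero] at h2
    rw [h2]
    exact mul_lt_mul_of_pos_right h6 hℓ0
  have hκpos : 0 < κ := by
    rcases hκ0.eq_or_lt with h | h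
    · rw [hκ2, ← h] at hΛ; rw [← h] at hΛ1; simp at hΛ hΛ1; linarith
    · exact h
  have hκm : 2 * (ρ - 1) < κ * m := by
    rw [hκ2] at hΛ
    have h1 : (ρ - 1) * κ * ℓ < κ ^ 2 * m ^ 2 / 2 := by linarith
    have h2 : κ ^ 2 * m ^ 2 / 2 ≤ κ * m / 2 * (κ * ℓ) := by
      have : κ * m / 2 * (κ * m) ≤ κ * m / 2 * (κ * ℓ) := by gcongr
      linarith
    have h3 : (ρ - 1) * (κ * ℓ) < κ * m / 2 * (κ * ℓ) := by linarith
    have := lt_of_mul_lt_mul_right h3 (by positivity)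
    linarith
  have hx1 : x1 ∈ Set.Icc x0 x1 := ⟨h01.le, le_rfl⟩
  have hVpos : 0 < V := lt_of_lt_of_le (lt_of_le_of_lt (by positivity) hΛ1) (hLV x1 hx1)
  set c := (E - 1) / V with hc
  have hE1' : 1 < E := Real.one_lt_exp_iff.2 hVpos
  have hc0 : 0 < c := div_pos (by linarith) hVpos
  have hcV : c * V = E - 1 := by rw [hc]; field_simp
  have chord : ∀ y, 0 ≤ y → y ≤ V → Real.exp y ≤ 1 + c * y := by
    intro y h1 h2
    have h3 := convexOn_exp.2 (Set.mem_univ (0:ℝ)) (Set.mem_univ V)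
      (sub_nonneg.2 ((div_le_one hVpos).2 h2)) (div_nonneg h1 hVpos.le) (by ring)
    simp only [smul_eq_mul, mul_zero, zero_add, Real.exp_zero, mul_one] at h3
    rw [div_mul_cancel₀ _ hVpos.ne'] at h3
    refine h3.trans (le_of_eq ?_)
    rw [hc, ← hE]; field_simp; ring
  have hH1 : ∀ t ∈ Set.Icc x0 x1, 1 ≤ E - c * L t := by
    intro t ht
    have : c * L t ≤ c * V := mul_le_mul_of_nonneg_left (hLV t ht) hc0.le
    linarith
  obtain ⟨ξ, h1, h2⟩ := exists_hasDerivAt_eq_slope (fun t => Real.sqrt (E - c * L t))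
    (fun t => -(c * w t) / (2 * Real.sqrt (E - c * L t))) h01 (by fun_prop) (by
      intro t ht
      have := hH1 t ⟨ht.1.le, ht.2.le⟩
      exact (((hL t).const_mul c).const_sub E).sqrt (by linarith))
  have hξ : ξ ∈ Set.Icc x0 x1 := ⟨h1.1.le, h1.2.le⟩
  set H := Real.sqrt (E - c * L ξ) with hH
  have hHp : 0 < H := Real.sqrt_pos.2 (by linarith [hH1 ξ hξ])
  have hHw : ρ * κ * H ≤ w ξ := by
    have h3 := hw2 ξ hξ
    have h4 := chord _ (hLpos ξ hξ) (hLV ξ hξ)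
    refine le_of_lt (lt_of_pow_lt_pow_left₀ 2 (hposw ξ hξ).le ?_)
    rw [mul_pow, mul_pow, hρ2, ← hκ2, hH, Real.sq_sqrt (by linarith [hH1 ξ hξ])]
    have : 2 * K1 * (E - c * L ξ) ≤ 2 * K1 * (1 + E - Real.exp (L ξ)) :=
      mul_le_mul_of_nonneg_left (by linarith) (by positivity)
    linarith
  have hHd : -(c * w ξ) / (2 * H) ≤ - (c * (ρ * κ)) / 2 := by
    rw [div_le_div_iff₀ (by positivity) (by norm_num)]
    have := mul_le_mul_of_nonneg_left hHw hc0.le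
    linarith
  have hx1H : 1 ≤ Real.sqrt (E - c * L x1) := Real.one_le_sqrt.2 (hH1 x1 hx1)
  have hx0H : Real.sqrt (E - c * L x0) = Real.exp (V / 2) := by
    rw [hL0, mul_zero, sub_zero, hE, Real.exp_half]
  rw [h2, div_le_iff₀ hℓ0, hx0H] at hHd
  set e := Real.exp (V / 2) with he
  have hee : E = e ^ 2 := by
    rw [hE, he, ← Real.exp_nat_mul]; congr 1; push_cast; ring
  have he1 : 1 < e := Real.one_lt_exp_iff.2 (by positivity)
  -- c ρ κ ℓ / 2 ≤ e - 1
  have h5 : c * (ρ * κ) / 2 * ℓ ≤ e - 1 := by linarith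
  have h6 : (e + 1) * (ρ * κ) / 2 * ℓ ≤ V := by
    have h7 := mul_le_mul_of_nonneg_right h5 hV
    have h8 : (e - 1) * ((e + 1) * (ρ * κ) / 2 * ℓ) ≤ (e - 1) * V := by
      calc (e - 1) * ((e + 1) * (ρ * κ) / 2 * ℓ) = (c * V) * (ρ * κ) / 2 * ℓ := by
            rw [hcV, hee]; ring
        _ = c * (ρ * κ) / 2 * ℓ * V := by ring
        _ ≤ _ := h7
    exact le_of_mul_le_mul_left h8 (by linarith)
  have h9 : 2 * (ρ - 1) < κ * ℓ := lt_of_lt_of_le hκm (by gcongr)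
  have h10 : (e + 1) * ρ * (ρ - 1) < V := by
    have : (e + 1) * ρ / 2 * (2 * (ρ - 1)) < (e + 1) * ρ / 2 * (κ * ℓ) := by gcongr
    linarith
  have h11 : ρ * (ρ - 1) = 2 - ρ := by linarith
  have h12 : (e + 1) * (2 - ρ) < V := by rw [← h11]; linarith
  have h13 := nexp_bound (v := V / 2) (by positivity)
  rw [← he] at h13
  have : (e + 1) * 0.585 ≤ (e + 1) * (2 - ρ) := by gcongr; linarith
  linarith

namespace NCore
variable {G D u s : ℤ → ℝ → ℝ} {S V M m β : ℝ} {Qp Qm T : ℝ → ℝ} {a p b p' q : ℤ}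

theorem le_m (h : NCore G D u s S V M m β Qp Qm T a p b p' q) (B : ℝ) (hB : 0 ≤ B) (c : ℝ) :
    B / (T c - c) ^ 2 ≤ B / m ^ 2 := by
  have := h.m0
  have := h.hm c
  gcongr

theorem fmax (h : NCore G D u s S V M m β Qp Qm T a p b p' q) (i r : ℤ) (hi : 0 ≤ i) (hr : 0 ≤ r)
    (hq : i + r ≤ q) (x : ℝ) :
    (u i x + u (-r) x) / 2 ≤ Real.sqrt (S * M * Real.exp V / m ^ 2) := by
  have hc : Continuous (fun x => (u i x + u (-r) x) / 2) := by
    have := (h.sys.jet i).contu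
    have := (h.sys.jet (-r)).contu
    fun_prop
  obtain ⟨y, hy⟩ := nper_max hc (fun l x => by
    simp only [(h.sys.per _ _ _).2.1])
  refine (hy x).trans ?_
  apply Real.le_sqrt_of_sq_le
  have hd : HasDerivAt (fun x => (u i x + u (-r) x) / 2) _ y :=
    (((h.sys.jet i).hu y).add ((h.sys.jet (-r)).hu y)).div_const 2
  have h0 := (IsLocalMax.hasDerivAt_eq_zero (Filter.Eventually.of_forall hy) hd)
  have h1 := h.s_split i r hi hr hq y y ⟨le_rfl, (h.ltT y).le⟩
  have hB : 0 ≤ S * M * Real.exp V := by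
    have := h.S0; have := h.M0; positivity
  have h2 := h.le_m _ hB y
  have h3 := neg_abs_le (s i y)
  have h4 := neg_abs_le (s (-r) y)
  have h5 := sq_nonneg (u i y - u (-r) y)
  nlinarith

theorem theta_osc (h : NCore G D u s S V M m β Qp Qm T a p b p' q) (y : ℝ)
    (hy : ∀ x, Real.log (D a x) ≤ Real.log (D a y)) (c z : ℝ)
    (hyc : y ∈ Set.Icc c (T c)) (hzc : z ∈ Set.Icc c (T c)) :
    Real.log (D a y) - Real.log (D a z) ≤ S * M * Real.exp V / 2 := by
  set B := S * M * Real.exp V / (T c - c) ^ 2 with hB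
  have hl : 0 < T c - c := by linarith [h.ltT c]
  have hB0 : 0 ≤ B := by have := h.S0; have := h.M0; positivity
  have hu0 : u a y = 0 :=
    IsLocalMax.hasDerivAt_eq_zero (Filter.Eventually.of_forall hy) ((h.sys.jet a).hlog y)
  have hψ : ∀ t, HasDerivAt (fun t => Real.log (D a t) + B / 2 * (t - y) ^ 2)
      (u a t + B * (t - y)) t := by
    intro t
    have := ((h.sys.jet a).hlog t).add ((((hasDerivAt_id t).sub_const y).pow 2).const_mul (B / 2))
    refine this.congr_deriv ?_
    simp; ring
  have hχ : ∀ t, HasDerivAt (fun t => u a t + B * (t - y)) (u a t ^ 2 / 2 + s a t + B) t := by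
    intro t
    have := ((h.sys.jet a).hu t).add (((hasDerivAt_id t).sub_const y).const_mul B)
    exact this.congr_deriv (by simp)
  obtain ⟨ξ, h1, h2⟩ := nmvt hψ y z
  obtain ⟨η, h3, h4⟩ := nmvt hχ y ξ
  simp only [hu0, sub_self, mul_zero, add_zero, sub_zero] at h4
  have hη : η ∈ Set.Icc c (T c) := by
    have hξ := Set.uIcc_subset_Icc hyc hzc h1
    exact Set.uIcc_subset_Icc hyc hξ h3
  have h5 : 0 ≤ u a η ^ 2 / 2 + s a η + B := by
    have := h.s_a c η hη
    have := neg_abs_le (s a η)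
    have := sq_nonneg (u a η)
    linarith
  have h6 : 0 ≤ (ξ - y) * (z - y) := by
    rcases Set.mem_uIcc.1 h1 with h | h
    · exact mul_nonneg (by linarith) (by linarith)
    · exact mul_nonneg_of_nonpos_of_nonpos (by linarith) (by linarith)
  rw [h4] at h2
  simp only [sub_self] at h2
  have h7 := mul_nonneg h5 h6
  have h8 : B / 2 * (z - y) ^ 2 ≤ B / 2 * (T c - c) ^ 2 := by
    apply mul_le_mul_of_nonneg_left _ (by positivity)
    apply sq_le_sq'
    · linarith [hyc.2, hzc.1]
    · linarith [hyc.1, hzc.2]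
  have h9 : B / 2 * (T c - c) ^ 2 = S * M * Real.exp V / 2 := by
    rw [hB]; field_simp
  linarith

theorem DT (h : NCore G D u s S V M m β Qp Qm T a p b p' q) (j : ℤ) (x : ℝ) :
    Real.log (D j (T x)) - Real.log (D j x) = Real.log (D a (G j x)) - Real.log (D a x) := by
  have h1 := h.sys.logD_add j a x
  have h2 := h.sys.logD_add a j x
  have h3 : D j (T x) = D j (G a x) := by
    rw [h.hT, sub_eq_add_neg, ← Int.cast_neg, (h.sys.per _ _ _).1]
  rw [add_comm] at h2
  rw [h3]; linarith

theorem lambda (h : NCore G D u s S V M m β Qp Qm T a p b p' q) (j : ℤ) (x : ℝ) :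
    Real.log (D j (T x)) - Real.log (D j x) ≤
      S * M * Real.exp V / 2 + (T x - x) * Real.sqrt (S * M * Real.exp V / m ^ 2) := by
  have hc : Continuous (fun x => Real.log (D a x)) :=
    continuous_iff_continuousAt.2 fun x => ((h.sys.jet a).hlog x).continuousAt
  obtain ⟨y, hy⟩ := nper_max hc (fun l x => by simp only [(h.sys.per _ _ _).1])
  obtain ⟨i, r, l1, l2, c, hi, hr, hq, hyc, h1, h2⟩ := h.cov x y
  have h3 := h.theta_osc y hy c _ hyc h1
  have h4 := h.theta_osc y hy c _ hyc h2
  rw [(h.sys.per _ _ _).1] at h3 h4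
  have h5 := h.DT i x
  have h6 := h.DT (-r) x
  have h7 := hy (G j x)
  obtain ⟨ξ, _, h8⟩ := nmvt (f := fun t => (Real.log (D i t) + Real.log (D (-r) t)) / 2)
    (fun t => (((h.sys.jet i).hlog t).add ((h.sys.jet (-r)).hlog t)).div_const 2) x (T x)
  have h9 := mul_le_mul_of_nonneg_right (h.fmax i r hi hr hq ξ)
    (sub_nonneg.2 (h.ltT x).le)
  rw [h.DT j x]
  linarith

theorem main (h : NCore G D u s S V M m β Qp Qm T a p b p' q) (j : ℤ) (hj : 0 ≤ j)
    (hj2 : j ≤ 2 * q) (x : ℝ) (hx : 0 < u j x) :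
    u j x ^ 2 ≤ 2 * (S * M * Real.exp V ^ 2 / m ^ 2) := by
  by_contra hcon
  push Not at hcon
  have hB : 0 ≤ S * M := mul_nonneg h.S0 h.M0.le
  have hm := h.m0
  have e2 : S * M * Real.exp V ^ 2 / m ^ 2 = S * M * Real.exp V / m ^ 2 * Real.exp V := by ring
  rw [e2] at hcon
  refine node (w := u j) (L := fun t => Real.log (D j t) - Real.log (D j x)) (sj := s j)
    (K1 := S * M * Real.exp V / m ^ 2) (V := V) (m := m) (h.ltT x)
    (fun t => ((h.sys.jet j).hlog t).sub_const _) (by simp) (h.sys.jet j).hu (by positivity)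
    h.V0 ?_ ?_ hx hcon hm (h.hm x) ?_
  · intro t ht
    have h1 := h.s_two j hj hj2 x t ht
    have h2 := h.le_m (S * M * Real.exp V) (by positivity) x
    have h3 := h.le_m (S * M * Real.exp V ^ 2) (by positivity) x
    have h4 := neg_abs_le (s j t)
    rw [e2] at h3
    linarith
  · intro t ht
    exact h.dist2 j hj hj2 x t x ht ⟨le_rfl, (h.ltT x).le⟩
  · have h1 := h.lambda j x
    have : S * M * Real.exp V / m ^ 2 * m ^ 2 / 2 = S * M * Real.exp V / 2 := by field_simp
    rw [this]
    exact h1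

end NCore

section NCF
variable {α : ℝ}

theorem ncf_irr (hα : Irrational α) (n : ℕ) : Irrational (cfGauss α n) := by
  induction n with
  | zero => exact hα
  | succ n ih =>
    rw [cfGauss]
    have : Irrational (Int.fract (cfGauss α n)) := by
      rw [Int.fract]; exact ih.sub_intCast _
    exact this.inv

theorem ncf_fract (hα : Irrational α) (n : ℕ) :
    0 < Int.fract (cfGauss α n) ∧ Int.fract (cfGauss α n) < 1 := by
  refine ⟨?_, Int.fract_lt_one _⟩
  refine lt_of_le_of_ne (Int.fract_nonneg _) fun h => ?_
  have h1 : cfGauss α n = ((⌊cfGauss α n⌋ : ℤ) : ℝ) := by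
    have := Int.fract_add_floor (cfGauss α n)
    linarith
  exact (ncf_irr hα n).ne_int _ h1

theorem ncf_A (hα : Irrational α) (n : ℕ) : 1 ≤ cfA α (n + 1) := by
  rw [cfA, Int.le_floor, cfGauss]
  have := ncf_fract hα n
  push_cast
  exact (one_le_inv₀ this.1).2 this.2.le

theorem ncf_A_eq (n : ℕ) :
    (cfA α (n + 1) : ℝ) = (Int.fract (cfGauss α n))⁻¹ - Int.fract (cfGauss α (n + 1)) := by
  have := Int.fract_add_floor (cfGauss α (n + 1))
  rw [cfA, eq_sub_iff_add_eq, add_comm, this, cfGauss]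

theorem ncf_Q1 (hα : Irrational α) : (cfQ α 1 : ℤ) = cfA α 1 := by
  rw [cfQ]; exact Int.toNat_of_nonneg (by linarith [ncf_A hα 0])

theorem ncf_Q2 (hα : Irrational α) (n : ℕ) :
    (cfQ α (n + 2) : ℤ) = cfA α (n + 2) * cfQ α (n + 1) + cfQ α n := by
  rw [cfQ]; push_cast
  have : ((cfA α (n + 2)).toNat : ℤ) = cfA α (n + 2) :=
    Int.toNat_of_nonneg (by linarith [ncf_A hα (n + 1)])
  rw [← this]; simp

theorem ncf_Qpos (hα : Irrational α) (n : ℕ) : 1 ≤ (cfQ α n : ℤ) ∧ (cfQ α n : ℤ) ≤ cfQ α (n + 1) := by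
  induction n with
  | zero =>
    rw [zero_add, ncf_Q1 hα]
    refine ⟨by simp [cfQ], ?_⟩
    have := ncf_A hα 0
    simpa [cfQ] using this
  | succ n ih =>
    refine ⟨ih.1.trans ih.2, ?_⟩
    rw [ncf_Q2 hα]
    have := ncf_A hα (n + 1)
    nlinarith

theorem ncf_delta (hα : Irrational α) (n : ℕ) :
    ((cfQ α (n + 1) : ℤ) : ℝ) * α - cfP α (n + 1) =
      - (((cfQ α n : ℤ) : ℝ) * α - cfP α n) * Int.fract (cfGauss α (n + 1)) := by
  induction n with
  | zero =>
    rw [zero_add, ncf_Q1 hα, cfP, cfP, cfQ]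
    have h1 := ncf_A_eq (α := α) 0
    rw [zero_add] at h1
    have h2 := ncf_fract hα 0
    have h3 : α - cfA α 0 = Int.fract (cfGauss α 0) := by
      rw [cfA, cfGauss, Int.self_sub_floor]
    push_cast
    have h4 : (cfA α 1 : ℝ) * Int.fract (cfGauss α 0) =
        1 - Int.fract (cfGauss α 1) * Int.fract (cfGauss α 0) := by
      rw [h1, sub_mul, inv_mul_cancel₀ h2.1.ne']
    rw [one_mul, h3]
    rw [← h3] at h4 ⊢
    linarith
  | succ n ih =>
    rw [ncf_Q2 hα, cfP]
    have h1 := ncf_A_eq (α := α) (n + 1)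
    have h2 := ncf_fract hα (n + 1)
    set f := Int.fract (cfGauss α (n + 1))
    set d := (((cfQ α n : ℤ) : ℝ) * α - cfP α n)
    have h4 : (cfA α (n + 2) : ℝ) * f = 1 - Int.fract (cfGauss α (n + 2)) * f := by
      rw [h1, sub_mul, inv_mul_cancel₀ h2.1.ne']
    have e : (((cfA α (n + 2) * cfQ α (n + 1) + cfQ α n : ℤ) : ℝ) * α -
        ((cfA α (n + 2) * cfP α (n + 1) + cfP α n : ℤ) : ℝ)) =
        cfA α (n + 2) * (((cfQ α (n + 1) : ℤ) : ℝ) * α - cfP α (n + 1)) + d := by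
      push_cast; simp only [d]; push_cast; ring
    rw [e, ih]
    linear_combination (-d) * h4

theorem ncf_d0 (hα : Irrational α) (n : ℕ) :
    ((cfQ α n : ℤ) : ℝ) * α - cfP α n ≠ 0 ∧ |((cfQ α n : ℤ) : ℝ) * α - cfP α n| < 1 := by
  induction n with
  | zero =>
    have h3 : ((cfQ α 0 : ℤ) : ℝ) * α - cfP α 0 = Int.fract (cfGauss α 0) := by
      rw [cfQ, cfP, cfA, cfGauss]; push_cast; rw [one_mul, Int.self_sub_floor]
    have := ncf_fract hα 0
    rw [h3, abs_of_pos this.1]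
    exact ⟨this.1.ne', this.2⟩
  | succ n ih =>
    rw [ncf_delta hα]
    have := ncf_fract hα (n + 1)
    refine ⟨mul_ne_zero (neg_ne_zero.2 ih.1) this.1.ne', ?_⟩
    rw [abs_mul, abs_neg, abs_of_pos this.1]
    nlinarith [abs_nonneg (((cfQ α n : ℤ) : ℝ) * α - cfP α n)]

theorem ncf_det (hα : Irrational α) (n : ℕ) :
    ((cfQ α n : ℤ) * cfP α (n + 1) - cfP α n * cfQ α (n + 1)) ^ 2 = 1 := by
  induction n with
  | zero => rw [zero_add, ncf_Q1 hα, cfP, cfP, cfQ]; push_cast; ring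
  | succ n ih =>
    rw [ncf_Q2 hα, cfP, ← ih]; ring

theorem nbest {β δ δ' : ℝ} {Q P Q' P' : ℤ} (hQ : 1 ≤ Q) (hdet : (Q * P' - P * Q') ^ 2 = 1)
    (h1 : δ = Q * β - P) (h2 : δ' = Q' * β - P') (h12 : δ * δ' < 0) (d l : ℤ) (hd : 0 < d)
    (hdQ : d < Q') : |δ| ≤ |d * β - l| := by
  set ε := Q * P' - P * Q' with hε
  set x := ε * (d * P' - l * Q') with hx
  set y := ε * (l * Q - d * P) with hy
  have ed : d = x * Q + y * Q' := by
    have : x * Q + y * Q' = ε ^ 2 * d := by rw [hx, hy, hε]; ring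
    rw [this, hdet]; ring
  have el : l = x * P + y * P' := by
    have : x * P + y * P' = ε ^ 2 * l := by rw [hx, hy, hε]; ring
    rw [this, hdet]; ring
  clear_value x y
  have e : (d * β - l : ℝ) = x * δ + y * δ' := by rw [ed, el, h1, h2]; push_cast; ring
  have hx0 : x ≠ 0 := by
    rintro rfl
    have : 0 < y := by by_contra hc; nlinarith
    nlinarith
  have hxy : x * y ≤ 0 := by
    by_contra hc
    push Not at hc
    rcases pos_and_pos_or_neg_and_neg_of_mul_pos hc with ⟨a, b⟩ | ⟨a, b⟩ <;> nlinarith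
  have hx1 : (1:ℝ) ≤ (x:ℝ) ^ 2 := by
    have : 0 < x ^ 2 := by positivity
    exact_mod_cast this
  have hxy' : (x:ℝ) * y ≤ 0 := by exact_mod_cast hxy
  rw [e]
  apply sq_le_sq.1
  have h3 : 0 ≤ ((x:ℝ) * y) * (δ * δ') := mul_nonneg_of_nonpos_of_nonpos hxy' h12.le
  have h4 : δ ^ 2 ≤ (x:ℝ) ^ 2 * δ ^ 2 := le_mul_of_one_le_left (sq_nonneg _) hx1
  nlinarith [sq_nonneg ((y:ℝ) * δ')]

theorem ncf_all (hα : Irrational α) (n : ℕ) :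
    ∃ a q p p' : ℤ, (cfQ α n : ℤ) = a ∧ (cfQ α (n + 1) : ℤ) = q ∧ cfP α n = p ∧ 1 ≤ a ∧ a ≤ q ∧
      (a * α - p) * (q * α - p') < 0 ∧ |q * α - p'| < |a * α - p| ∧ |a * α - p| < 1 ∧
      ∀ d l : ℤ, 0 < d → d < q → |a * α - p| ≤ |d * α - l| := by
  have h1 := ncf_d0 hα n
  have h2 := ncf_fract hα (n + 1)
  have h3 := ncf_delta hα n
  have h4 : (((cfQ α n : ℤ) : ℝ) * α - cfP α n) *
      (((cfQ α (n + 1) : ℤ) : ℝ) * α - cfP α (n + 1)) < 0 := by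
    rw [h3]
    have := mul_pos (pow_pos (abs_pos.2 h1.1) 2) h2.1
    rw [sq_abs] at this
    linarith
  refine ⟨cfQ α n, cfQ α (n + 1), cfP α n, cfP α (n + 1), rfl, rfl, rfl, (ncf_Qpos hα n).1,
    (ncf_Qpos hα n).2, h4, ?_, h1.2, ?_⟩
  · rw [h3, abs_mul, abs_neg, abs_of_pos h2.1]
    exact mul_lt_of_lt_one_right (abs_pos.2 h1.1) h2.2
  · exact fun d l hd hdq => nbest (ncf_Qpos hα n).1 (ncf_det hα n) rfl rfl h4 d l hd hdq

end NCF

theorem nbv {f f' : ℝ → ℝ} (hf : ∀ x, HasDerivAt f (f' x) x) (hc : Continuous f') :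
    LocallyBoundedVariationOn f Set.univ := by
  intro a b _ _
  rw [Set.univ_inter]
  obtain ⟨C, hC⟩ := isCompact_Icc.exists_bound_of_continuousOn (s := Set.Icc a b) hc.continuousOn
  have hL : LipschitzOnWith (Real.toNNReal C) f (Set.Icc a b) := by
    apply (convex_Icc a b).lipschitzOnWith_of_nnnorm_hasDerivWithin_le
      (f' := f') (fun x _ => (hf x).hasDerivWithinAt)
    intro x hx
    have := hC x hx
    rw [← NNReal.coe_le_coe, coe_nnnorm]
    exact this.trans (Real.le_coe_toNNReal C)
  by_cases hab : a ≤ b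
  · have := hL.locallyBoundedVariationOn a b ⟨le_rfl, hab⟩ ⟨hab, le_rfl⟩
    rwa [Set.inter_self] at this
  · rw [Set.Icc_eq_empty hab]
    simp

theorem nvar_shift {f : ℝ → ℝ} (h1 : ∀ x, f (x + 1) = f x) (a b : ℝ) :
    eVariationOn f (Set.Icc (a + 1) (b + 1)) = eVariationOn f (Set.Icc a b) := by
  have h := eVariationOn.comp_eq_of_monotoneOn f (t := Set.Icc a b) (fun x => x + 1)
    (fun x _ y _ h => by simpa using h)
  rw [Set.image_add_const_Icc] at h
  rw [← h]
  congr 1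
  funext x
  exact h1 x

theorem nvar {f : ℝ → ℝ} (hb : LocallyBoundedVariationOn f Set.univ) (h1 : ∀ x, f (x + 1) = f x)
    {V : ℝ} (hV : V = (eVariationOn f (Set.Icc 0 1)).toReal) :
    ∃ Qp Qm : ℝ → ℝ, Monotone Qp ∧ Monotone Qm ∧ (∀ x, Qp (x + 1) = Qp x + V / 2) ∧
      (∀ x, Qm (x + 1) = Qm x + V / 2) ∧ (∀ x y, x ≤ y → f y - f x ≤ Qp y - Qp x) ∧
      (∀ x y, x ≤ y → f x - f y ≤ Qm y - Qm x) := by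
  set v : ℝ → ℝ := fun x => variationOnFromTo f Set.univ 0 x with hv
  have hsub : ∀ x y, x ≤ y → |f y - f x| ≤ v y - v x := by
    intro x y hxy
    have h2 := variationOnFromTo.add hb (Set.mem_univ 0) (Set.mem_univ x) (Set.mem_univ y)
    have h3 := variationOnFromTo.eq_of_le f Set.univ hxy
    have h4 : edist (f y) (f x) ≤ eVariationOn f (Set.univ ∩ Set.Icc x y) :=
      eVariationOn.edist_le f ⟨trivial, hxy, le_rfl⟩ ⟨trivial, le_rfl, hxy⟩
    have h5 := ENNReal.toReal_mono (hb x y trivial trivial) h4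
    rw [edist_dist, ENNReal.toReal_ofReal dist_nonneg, Real.dist_eq] at h5
    simp only [hv]
    linarith
  have hper : ∀ x, f (x + 1) = f x := h1
  have hv1 : ∀ x, v (x + 1) = v x + V := by
    intro x
    have h2 := variationOnFromTo.add hb (Set.mem_univ 0) (Set.mem_univ 1) (Set.mem_univ (x + 1))
    have h3 := variationOnFromTo.eq_of_le f Set.univ (zero_le_one (α := ℝ))
    rw [Set.univ_inter, ← hV] at h3
    have h4 : variationOnFromTo f Set.univ 1 (x + 1) = variationOnFromTo f Set.univ 0 x := by
      rcases le_total 0 x with hx | hx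
      · rw [variationOnFromTo.eq_of_le f Set.univ hx,
          variationOnFromTo.eq_of_le f Set.univ (by linarith : (1:ℝ) ≤ x + 1), Set.univ_inter,
          Set.univ_inter, ← nvar_shift h1 0 x, zero_add]
      · rw [variationOnFromTo.eq_of_ge f Set.univ hx,
          variationOnFromTo.eq_of_ge f Set.univ (by linarith : x + 1 ≤ (1:ℝ)), Set.univ_inter,
          Set.univ_inter, ← nvar_shift h1 x 0, zero_add]
    simp only [hv]
    linarith
  refine ⟨fun x => (v x + f x) / 2, fun x => (v x - f x) / 2, ?_, ?_, ?_, ?_, ?_, ?_⟩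
  · intro x y hxy
    have := abs_le.1 (hsub x y hxy)
    simp only; linarith
  · intro x y hxy
    have := abs_le.1 (hsub x y hxy)
    simp only; linarith
  · intro x; simp only [hv1, h1]; ring
  · intro x; simp only [hv1, h1]; ring
  · intro x y hxy
    have := abs_le.1 (hsub x y hxy)
    simp only; linarith
  · intro x y hxy
    have := abs_le.1 (hsub x y hxy)
    simp only; linarith

theorem ninst {G D u s : ℤ → ℝ → ℝ} {S V M m β : ℝ} {Qp Qm : ℝ → ℝ} {a p p' q : ℤ}
    (sys : NSys G D u s S) (S0 : 0 ≤ S) (V0 : 0 ≤ V)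
    (QpM : Monotone Qp) (QmM : Monotone Qm)
    (Qp1 : ∀ x, Qp (x + 1) = Qp x + V / 2) (Qm1 : ∀ x, Qm (x + 1) = Qm x + V / 2)
    (QpF : ∀ x y, x ≤ y → Real.log (D 1 y) - Real.log (D 1 x) ≤ Qp y - Qp x)
    (QmF : ∀ x y, x ≤ y → Real.log (D 1 x) - Real.log (D 1 y) ≤ Qm y - Qm x)
    (hβ : Irrational β)
    (sgn1 : ∀ (k l : ℤ) x, k * β < l → G k x < x + l)
    (sgn2 : ∀ (k l : ℤ) x, l < k * β → x + l < G k x)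
    (ha : 1 ≤ a) (haq : a ≤ q) (hopp : (a * β - p) * (q * β - p') < 0)
    (hlt : |q * β - p'| < |a * β - p|) (hlt1 : |a * β - p| < 1)
    (best : ∀ d l : ℤ, 0 < d → d < q → |a * β - p| ≤ |d * β - l|)
    (m0 : 0 < m) (hm : ∀ x, m ≤ |G a x - p - x|) (hM : ∀ x, |G a x - p - x| ≤ M)
    (j : ℤ) (hj : 0 ≤ j) (hj2 : j ≤ 2 * q) (x : ℝ) (hx : 0 < u j x) :
    u j x ^ 2 ≤ 2 * (S * M * Real.exp V ^ 2 / m ^ 2) := by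
  have eq0 : ∀ k l : ℤ, k * β = l → k = 0 ∧ l = 0 := by
    intro k l hkl
    have hk : k = 0 := by
      by_contra hk
      exact (hβ.intCast_mul hk).ne_int l hkl
    subst hk
    refine ⟨rfl, ?_⟩
    have : (l : ℝ) = 0 := by rw [← hkl]; simp
    exact_mod_cast this
  have sgn1w : ∀ (k l : ℤ) x, k * β ≤ l → G k x ≤ x + l := by
    intro k l x h
    rcases h.eq_or_lt with h | h
    · obtain ⟨rfl, rfl⟩ := eq0 k l h
      simp [sys.G0]
    · exact (sgn1 k l x h).le
  have sgn2w : ∀ (k l : ℤ) x, l ≤ k * β → x + l ≤ G k x := by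
    intro k l x h
    rcases h.eq_or_lt with h | h
    · obtain ⟨rfl, rfl⟩ := eq0 k l h.symm
      simp [sys.G0]
    · exact (sgn2 k l x h).le
  rcases lt_trichotomy 0 (a * β - p) with hd | hd | hd
  · have hd' : q * β - p' < 0 := by
      by_contra hc; push Not at hc; linarith [mul_nonneg hd.le hc]
    rw [abs_of_pos hd] at hlt hlt1 best
    rw [abs_of_neg hd'] at hlt
    have hpos : ∀ x, 0 < G a x - p - x := fun x => by
      have := sgn2 a p x (by linarith); linarith
    have core : NCore G D u s S V M m β Qp Qm (fun x => G a x - p) a p q p' q :=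
      ⟨sys, S0, V0, QpM, QmM, Qp1, Qm1, QpF, QmF, sgn1, sgn2, sgn1w, sgn2w, hd, hlt1, hd',
        by linarith, Or.inl ⟨ha, haq, rfl⟩, best, fun _ => rfl, m0,
        fun x => by have := hm x; rwa [abs_of_pos (hpos x)] at this,
        fun x => by have := hM x; rwa [abs_of_pos (hpos x)] at this⟩
    exact core.main j hj hj2 x hx
  · rw [← hd] at hopp; simp at hopp
  · have hd' : 0 < q * β - p' := by
      by_contra hc; push Not at hc; linarith [mul_nonneg_of_nonpos_of_nonpos hd.le hc]
    rw [abs_of_neg hd] at hlt hlt1 best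
    rw [abs_of_pos hd'] at hlt
    have hpos : ∀ x, 0 < G (-a) x + p - x := fun x => by
      have := sgn2 (-a) (-p) x (by push_cast; linarith); push_cast at this; linarith
    have hz : ∀ x, |G a (G (-a) x + p) - p - (G (-a) x + p)| = G (-a) x + p - x := fun x => by
      rw [sys.Gper, sys.Gneg, ← abs_neg,
        show -(x + p - p - (G (-a) x + p)) = G (-a) x + p - x by ring, abs_of_pos (hpos x)]
    have core : NCore G D u s S V M m β Qp Qm (fun x => G (-a) x + p) (-a) (-p) (-q) (-p') q :=
      ⟨sys, S0, V0, QpM, QmM, Qp1, Qm1, QpF, QmF, sgn1, sgn2, sgn1w, sgn2w,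
        by push_cast; linarith, by push_cast; linarith, by push_cast; linarith,
        by push_cast; linarith, Or.inr ⟨by omega, by omega, rfl⟩,
        fun d l h1 h2 => by have := best d l h1 h2; push_cast; linarith,
        fun _ => by push_cast; ring, m0,
        fun x => by have := hm (G (-a) x + p); rwa [hz] at this,
        fun x => by have := hM (G (-a) x + p); rwa [hz] at this⟩
    exact core.main j hj hj2 x hx

theorem ninst_refl {G D u s : ℤ → ℝ → ℝ} {S V M m β : ℝ} {Qp Qm : ℝ → ℝ} {a p p' q : ℤ}
    (sys : NSys G D u s S) (S0 : 0 ≤ S) (V0 : 0 ≤ V)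
    (QpM : Monotone Qp) (QmM : Monotone Qm)
    (Qp1 : ∀ x, Qp (x + 1) = Qp x + V / 2) (Qm1 : ∀ x, Qm (x + 1) = Qm x + V / 2)
    (QpF : ∀ x y, x ≤ y → Real.log (D 1 y) - Real.log (D 1 x) ≤ Qp y - Qp x)
    (QmF : ∀ x y, x ≤ y → Real.log (D 1 x) - Real.log (D 1 y) ≤ Qm y - Qm x)
    (hβ : Irrational β)
    (sgn1 : ∀ (k l : ℤ) x, k * β < l → G k x < x + l)
    (sgn2 : ∀ (k l : ℤ) x, l < k * β → x + l < G k x)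
    (ha : 1 ≤ a) (haq : a ≤ q) (hopp : (a * β - p) * (q * β - p') < 0)
    (hlt : |q * β - p'| < |a * β - p|) (hlt1 : |a * β - p| < 1)
    (best : ∀ d l : ℤ, 0 < d → d < q → |a * β - p| ≤ |d * β - l|)
    (m0 : 0 < m) (hm : ∀ x, m ≤ |G a x - p - x|) (hM : ∀ x, |G a x - p - x| ≤ M)
    (j : ℤ) (hj : 0 ≤ j) (hj2 : j ≤ 2 * q) (x : ℝ) (hx : u j x < 0) :
    u j x ^ 2 ≤ 2 * (S * M * Real.exp V ^ 2 / m ^ 2) := by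
  have en : ∀ c d : ℤ, |(c : ℝ) * (-β) - ((-d : ℤ) : ℝ)| = |c * β - d| := fun c d => by
    rw [← abs_neg]; congr 1; push_cast; ring
  have key := ninst (sys := sys.refl) (S0 := S0) (V0 := V0) (M := M) (m := m) (β := -β)
    (Qp := fun x => - Qm (-x)) (Qm := fun x => - Qp (-x)) (a := a) (p := -p) (p' := -p') (q := q)
    (fun x y h => by simpa using QmM (neg_le_neg h))
    (fun x y h => by simpa using QpM (neg_le_neg h))
    (fun x => by
      have := Qm1 (-(x + 1))
      have e : -(x + 1) + 1 = -x := by ring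
      rw [e] at this
      linarith)
    (fun x => by
      have := Qp1 (-(x + 1))
      have e : -(x + 1) + 1 = -x := by ring
      rw [e] at this
      linarith)
    (fun x y h => by have := QmF _ _ (neg_le_neg h); linarith)
    (fun x y h => by have := QpF _ _ (neg_le_neg h); linarith)
    hβ.neg
    (fun k l x h => by
      have := sgn2 k (-l) (-x) (by push_cast; linarith)
      push_cast at this; linarith)
    (fun k l x h => by
      have := sgn1 k (-l) (-x) (by push_cast; linarith)
      push_cast at this; linarith)
    ha haq (by push_cast; linarith) (by rw [en, en]; exact hlt) (by rw [en]; exact hlt1)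
    (fun d l h1 h2 => by
      have := best d (-l) h1 h2
      rw [← en, ← en d, neg_neg] at this
      exact this)
    m0
    (fun x => by
      have := hm (-x)
      rw [← abs_neg] at this
      convert this using 2
      push_cast; ring)
    (fun x => by
      have := hM (-x)
      rw [← abs_neg] at this
      convert this using 2
      push_cast; ring)
    j hj hj2 (-x) (by simpa using hx)
  simpa using key

theorem nsgn {g : ℝ → ℝ} (hgmono : StrictMono g) (hgper : ∀ x, g (x + 1) = g x + 1)
    {α : ℝ} (hrot : ∀ x : ℝ, Tendsto (fun m : ℕ => (g^[m] x - x) / m) atTop (𝓝 α)) (n : ℕ) (l : ℤ)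
    (x : ℝ) : (n * α < l → g^[n] x < x + l) ∧ (l < n * α → x + l < g^[n] x) := by
  set F : CircleDeg1Lift := ⟨⟨g, hgmono.monotone⟩, hgper⟩ with hF
  have hFg : ∀ n x, (F ^ n) x = g^[n] x := fun n x => by
    rw [CircleDeg1Lift.coe_pow]; rfl
  have hτ : CircleDeg1Lift.translationNumber F = α := by
    refine tendsto_nhds_unique (F.tendsto_translationNumber 0) ?_
    simp only [hFg]
    exact hrot 0
  have hτn : CircleDeg1Lift.translationNumber (F ^ n) = n * α := by
    rw [CircleDeg1Lift.translationNumber_pow, hτ]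
  rw [← hFg, ← hτn]
  exact ⟨fun h => CircleDeg1Lift.map_lt_of_translationNumber_lt_int _ h x,
    fun h => CircleDeg1Lift.lt_map_of_int_lt_translationNumber _ h x⟩

theorem njet_of {g : ℝ → ℝ} (hg : ContDiff ℝ 3 g) (hgder : ∀ x, 0 < deriv g x) :
    NJet g (deriv g) (fun x => iteratedDeriv 2 g x / deriv g x) (schwarzianDeriv g) := by
  have e2 : iteratedDeriv 2 g = deriv (deriv g) := by
    rw [iteratedDeriv_succ, iteratedDeriv_one]
  have e3 : iteratedDeriv 3 g = deriv (iteratedDeriv 2 g) := by rw [← iteratedDeriv_succ]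
  have d1 : Differentiable ℝ g := hg.differentiable (by norm_num)
  have d2 : Differentiable ℝ (deriv g) := by
    have := hg.differentiable_iteratedDeriv 1 (by norm_num)
    rwa [iteratedDeriv_one] at this
  have d3 : Differentiable ℝ (iteratedDeriv 2 g) :=
    hg.differentiable_iteratedDeriv 2 (by norm_num)
  have h2 : ∀ x, HasDerivAt (deriv g) (iteratedDeriv 2 g x) x := fun x => by
    rw [e2]; exact (d2 x).hasDerivAt
  have h3 : ∀ x, HasDerivAt (iteratedDeriv 2 g) (iteratedDeriv 3 g x) x := fun x => by
    rw [e3]; exact (d3 x).hasDerivAt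
  refine ⟨fun x => (d1 x).hasDerivAt, hgder, fun x => ?_, fun x => ?_⟩
  · refine (h2 x).congr_deriv ?_
    rw [mul_div_cancel₀ _ (hgder x).ne']
  · refine ((h3 x).div (h2 x) (hgder x).ne').congr_deriv ?_
    have := (hgder x).ne'
    rw [schwarzianDeriv]
    field_simp
    ring

theorem nsys_exists {g : ℝ → ℝ} (hg : ContDiff ℝ 3 g) (hgmono : StrictMono g)
    (hgsurj : Function.Surjective g) (hgder : ∀ x, 0 < deriv g x)
    (hgper : ∀ x, g (x + 1) = g x + 1) {S : ℝ} (hS : ∀ x, |schwarzianDeriv g x| ≤ S) :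
    ∃ G D u s : ℤ → ℝ → ℝ, NSys G D u s S ∧ (∀ (n : ℕ), G n = g^[n]) ∧ D 1 = deriv g := by
  set e : Equiv.Perm ℝ := Equiv.ofBijective g ⟨hgmono.injective, hgsurj⟩ with he
  have heg : ∀ x, e x = g x := fun x => rfl
  have J1 : NJet (e : ℝ → ℝ) (deriv g) (fun x => iteratedDeriv 2 g x / deriv g x)
    (schwarzianDeriv g) := njet_of hg hgder
  have hmono : Monotone (e.symm : ℝ → ℝ) := by
    intro x y hxy
    rw [← hgmono.le_iff_le, ← heg, ← heg, e.apply_symm_apply, e.apply_symm_apply]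
    exact hxy
  have Ji := J1.inv (k := e.symm) (hmono.continuous_of_surjective e.symm.surjective)
    e.apply_symm_apply
  have hex : ∀ i : ℤ, ∃ D u s, NJet ((e ^ i : Equiv.Perm ℝ) : ℝ → ℝ) D u s := by
    intro i
    induction i using Int.induction_on with
    | zero => exact ⟨_, _, _, NJet.id⟩
    | succ k ih =>
      obtain ⟨D, u, s, h⟩ := ih
      have := h.comp J1
      rw [zpow_add_one]
      exact ⟨_, _, _, this⟩
    | pred k ih =>
      obtain ⟨D, u, s, h⟩ := ih
      have := h.comp Ji
      rw [zpow_sub_one]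
      exact ⟨_, _, _, this⟩
  choose D u s hJ using hex
  have h1 : D 1 = deriv g ∧ (u 1 = fun x => iteratedDeriv 2 g x / deriv g x) ∧
      s 1 = schwarzianDeriv g := by
    have := hJ 1
    rw [zpow_one] at this
    exact this.unique J1
  refine ⟨fun i => ((e ^ i : Equiv.Perm ℝ) : ℝ → ℝ), D, u, s, ⟨hJ, fun x => rfl, ?_, ?_, ?_⟩, ?_,
    h1.1⟩
  · intro i j x
    simp only [zpow_add, Equiv.Perm.mul_apply]
  · intro i x
    have hc : Commute e (Equiv.addRight (1:ℝ)) := by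
      ext y
      simp [Equiv.Perm.mul_apply, heg, hgper]
    have := congrArg (fun f : Equiv.Perm ℝ => f x) (hc.zpow_left i).eq
    simpa [Equiv.Perm.mul_apply] using this
  · intro x; rw [h1.2.2]; exact hS x
  · intro n
    simp only [zpow_natCast]
    rw [← Equiv.Perm.iterate_eq_pow]; rfl

/-- **Nonlinearity estimate for iterates.**
Let `g` be the lift of an orientation-preserving `C³` circle diffeomorphism with irrational
rotation number `α`, `S = sup |Sg|`, `V = Var_{[0,1]} log g′` and `c = √(2S) e^V`.  Then for
all `n` and `0 ≤ j ≤ 2q_{n+1}`, `sup_x |(g^j)″(x)/(g^j)′(x)| ≤ c Mₙ^{1/2} / mₙ*`. -/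
theorem nonlinearity_estimate_for_iterates
    (g : ℝ → ℝ) (hg : ContDiff ℝ 3 g) (hgmono : StrictMono g)
    (hgsurj : Function.Surjective g) (hgder : ∀ x, 0 < deriv g x)
    (hgper : ∀ x, g (x + 1) = g x + 1)
    (α : ℝ) (hα : Irrational α)
    (hrot : ∀ x : ℝ, Tendsto (fun m : ℕ => (g^[m] x - x) / m) atTop (𝓝 α))
    (S V c : ℝ)
    (hS : S = ⨆ x : ℝ, |schwarzianDeriv g x|)
    (hV : V = (eVariationOn (fun t => Real.log (deriv g t)) (Set.Icc 0 1)).toReal)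
    (hc : c = Real.sqrt (2 * S) * Real.exp V)
    (n : ℕ) (j : ℕ) (hj : j ≤ 2 * cfQ α (n + 1)) (x : ℝ) :
    |iteratedDeriv 2 (g^[j]) x / deriv (g^[j]) x| ≤
      c * Real.sqrt (⨆ y : ℝ, |cfIter g α n y - y|) /
        (⨅ y : ℝ, |cfIter g α n y - y|) := by
  -- the Schwarzian is bounded by `S`
  have J1 := njet_of hg hgder
  have hbS : ∀ x, |schwarzianDeriv g x| ≤ S := by
    have hcont : Continuous (schwarzianDeriv g) := by
      have c3 := hg.continuous_iteratedDeriv 3 (by norm_num)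
      have c2 := hg.continuous_iteratedDeriv 2 (by norm_num)
      have c1 := J1.contD
      have : ∀ x, deriv g x ≠ 0 := fun x => (hgder x).ne'
      have e : schwarzianDeriv g = fun x => iteratedDeriv 3 g x / deriv g x -
        (3 / 2) * (iteratedDeriv 2 g x / deriv g x) ^ 2 := rfl
      rw [e]
      exact (c3.div c1 this).sub (continuous_const.mul ((c2.div c1 this).pow 2))
    have hp1 : ∀ x, schwarzianDeriv g (x + 1) = schwarzianDeriv g x := by
      have h1 := J1.shift 1 (-1)
      have e : (fun x => g (x + 1) + (-1)) = g := by funext y; rw [hgper]; ring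
      rw [e] at h1
      exact fun x => congrFun (h1.unique J1).2.2 x
    obtain ⟨y, hy⟩ := nper_max (f := fun x => |schwarzianDeriv g x|) hcont.abs (fun l x => by
      have := nper_int (C := 0) (Q := schwarzianDeriv g) (by simpa using hp1) l x
      simp only [this]; simp)
    intro x
    rw [hS]
    exact le_ciSup (f := fun x => |schwarzianDeriv g x|) ⟨_, by rintro _ ⟨x, rfl⟩; exact hy x⟩ x
  have S0 : 0 ≤ S := (abs_nonneg _).trans (hbS 0)
  have V0 : 0 ≤ V := by rw [hV]; exact ENNReal.toReal_nonneg
  obtain ⟨G, D, u, s, sys, hGn, hD1⟩ := nsys_exists hg hgmono hgsurj hgder hgper hbS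
  -- variation
  have hb : LocallyBoundedVariationOn (fun t => Real.log (deriv g t)) Set.univ :=
    nbv J1.hlog J1.contu
  have hper : ∀ x, Real.log (deriv g (x + 1)) = Real.log (deriv g x) := by
    intro x
    rw [← hD1, (sys.per1 1 x).1]
  obtain ⟨Qp, Qm, q1, q2, q3, q4, q5, q6⟩ := nvar hb hper hV
  -- signs
  have sgn1 : ∀ (k l : ℤ) x, k * α < l → G k x < x + l := by
    intro k l x h
    rcases Int.eq_nat_or_neg k with ⟨i, rfl | rfl⟩
    · rw [hGn]
      exact (nsgn hgmono hgper hrot i l x).1 (by push_cast at h; exact h)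
    · have := (nsgn hgmono hgper hrot i (-l) (G (-i) x)).2 (by push_cast at h ⊢; linarith)
      rw [← hGn, sys.Gneg] at this
      push_cast at this; linarith
  have sgn2 : ∀ (k l : ℤ) x, l < k * α → x + l < G k x := by
    intro k l x h
    rcases Int.eq_nat_or_neg k with ⟨i, rfl | rfl⟩
    · rw [hGn]
      exact (nsgn hgmono hgper hrot i l x).2 (by push_cast at h; exact h)
    · have := (nsgn hgmono hgper hrot i (-l) (G (-i) x)).1 (by push_cast at h ⊢; linarith)
      rw [← hGn, sys.Gneg] at this
      push_cast at this; linarith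
  obtain ⟨a, q, p, p', ea, eq, ep, ha, haq, hopp, hlt, hlt1, best⟩ := ncf_all hα n
  have hit : ∀ y, cfIter g α n y = G a y - p := by
    intro y; rw [cfIter, ← ea, hGn, ep]
  simp only [hit]
  set φ : ℝ → ℝ := fun y => |G a y - p - y| with hφ
  have φc : Continuous φ := by
    have := (sys.jet a).cont
    fun_prop
  have φp : ∀ (l : ℤ) y, φ (y + l) = φ y := by
    intro l y
    simp only [hφ, sys.Gper]; congr 1; ring
  obtain ⟨y1, hy1⟩ := nper_max φc φp
  obtain ⟨y2, hy2⟩ := nper_max (f := fun y => - φ y) φc.neg (fun l y => by rw [φp])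
  have φpos : 0 < φ y2 := by
    rw [hφ, abs_pos]
    rcases lt_trichotomy (a * α - p) 0 with h | h | h
    · have := sgn1 a p y2 (by linarith); intro h'; linarith
    · rw [h] at hopp; simp at hopp
    · have := sgn2 a p y2 (by linarith); intro h'; linarith
  have hM : ∀ y, φ y ≤ ⨆ y, φ y := fun y =>
    le_ciSup (f := φ) ⟨_, by rintro _ ⟨x, rfl⟩; exact hy1 x⟩ y
  have hm : ∀ y, (⨅ y, φ y) ≤ φ y := fun y =>
    ciInf_le (f := φ) ⟨φ y2, by rintro _ ⟨x, rfl⟩; have := hy2 x; linarith⟩ y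
  have m0 : 0 < ⨅ y, φ y :=
    lt_of_lt_of_le φpos (le_ciInf fun y => by have := hy2 y; linarith)
  set M := ⨆ y, φ y with hMdef
  set m := ⨅ y, φ y with hmdef
  have hjq : (j : ℤ) ≤ 2 * q := by rw [← eq]; exact_mod_cast hj
  have hM0 : 0 ≤ M := (abs_nonneg _).trans (hM 0)
  have main : u j x ^ 2 ≤ 2 * (S * M * Real.exp V ^ 2 / m ^ 2) := by
    rcases lt_trichotomy (u j x) 0 with h | h | h
    · exact ninst_refl sys S0 V0 q1 q2 q3 q4 (by rw [hD1]; exact q5) (by rw [hD1]; exact q6) hα sgn1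
        sgn2 ha haq hopp hlt hlt1 best m0 hm hM j (by positivity) hjq x h
    · rw [h, zero_pow two_ne_zero]; positivity
    · exact ninst sys S0 V0 q1 q2 q3 q4 (by rw [hD1]; exact q5) (by rw [hD1]; exact q6) hα sgn1
        sgn2 ha haq hopp hlt hlt1 best m0 hm hM j (by positivity) hjq x h
  -- identify the nonlinearity
  have hu : iteratedDeriv 2 (g^[j]) x / deriv (g^[j]) x = u j x := by
    have hJ := sys.jet j
    rw [hGn] at hJ
    have e1 : deriv (g^[j]) = D j := funext fun y => (hJ.hf y).deriv
    rw [iteratedDeriv_succ, iteratedDeriv_one, e1, (hJ.hD x).deriv,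
      mul_div_cancel_left₀ _ (hJ.pos x).ne']
  rw [hu]
  apply abs_le_of_sq_le_sq
  · refine main.trans (le_of_eq ?_)
    rw [hc, div_pow, mul_pow, mul_pow, Real.sq_sqrt hM0, Real.sq_sqrt (by positivity)]
    ring
  · rw [hc]; positivity
end
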